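/- As δ → 0⁺ one has: ρ^δ → 0 and p^δ → 0 uniformly on (2M,∞); λ^δ → λ⁰ uniformly on (2M,∞); M^δ → 0; E^δ → E⁰; and μ^δ is twice continuously differentiable on (2M,∞) with (μ^δ)^(k) → (μ⁰)^(k) uniformly on (2M,∞) for k = 0, 1, 2. -/

import Mathlib

open Real MeasureTheory Set Filter Topology intervalIntegral

noncomputable section

/-- The Schwarzschild effective potential. -/
def Psi0 (M L r : ℝ) : ℝ :=
  Real.sqrt (1 - 2 * M / r) * Real.sqrt (1 + L / r ^ 2)

/-- The constant `c_l`. -/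
def cConst (l : ℝ) : ℝ := ∫ s in (0:ℝ)..1, s ^ l / Real.sqrt (1 - s)

/-- The constant `d_l`. -/
def dConst (l : ℝ) : ℝ := ∫ s in (0:ℝ)..1, s ^ l * Real.sqrt (1 - s)

/-- The function `G(r,y)`. -/
def Gfun (l L₀ : ℝ) (Φ : ℝ → ℝ) (r y : ℝ) : ℝ :=
  if Real.exp (-y) * Real.sqrt (1 + L₀ / r ^ 2) < 1 then
    2 * π * cConst l * r ^ (2 * l) * Real.exp (3 * y) *
      ∫ α in (0:ℝ)..(1 - Real.exp (-y) * Real.sqrt (1 + L₀ / r ^ 2)),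
        Φ α * (1 - α) ^ 2 *
          (Real.exp (2 * y) * (1 - α) ^ 2 - 1 - L₀ / r ^ 2) ^ (l + 1 / 2)
  else 0

/-- The function `H(r,y)`. -/
def Hfun (l L₀ : ℝ) (Φ : ℝ → ℝ) (r y : ℝ) : ℝ :=
  if Real.exp (-y) * Real.sqrt (1 + L₀ / r ^ 2) < 1 then
    2 * π * dConst l * r ^ (2 * l) * Real.exp y *
      ∫ α in (0:ℝ)..(1 - Real.exp (-y) * Real.sqrt (1 + L₀ / r ^ 2)),
        Φ α * (Real.exp (2 * y) * (1 - α) ^ 2 - 1 - L₀ / r ^ 2) ^ (l + 3 / 2)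
  else 0

/-- `ρ[y]`. -/
def rhoFun (l L₀ δ r₀ : ℝ) (Φ χ : ℝ → ℝ) (y : ℝ → ℝ) (r : ℝ) : ℝ :=
  δ * χ (r - r₀) * Gfun l L₀ Φ r (y r)

/-- `p[y]`. -/
def pFun (l L₀ δ r₀ : ℝ) (Φ χ : ℝ → ℝ) (y : ℝ → ℝ) (r : ℝ) : ℝ :=
  δ * χ (r - r₀) * Hfun l L₀ Φ r (y r)

/-- `m[y]`. -/
def mFun (M l L₀ δ r₀ : ℝ) (Φ χ : ℝ → ℝ) (y : ℝ → ℝ) (r : ℝ) : ℝ :=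
  4 * π * ∫ s in (2 * M)..r, s ^ 2 * rhoFun l L₀ δ r₀ Φ χ y s

/-- `y` is a `C¹` solution of the initial value problem on `(2M,∞)`. -/
def IsShellSolution (M l L₀ δ r₀ y₀ : ℝ) (Φ χ : ℝ → ℝ) (y : ℝ → ℝ) : Prop :=
  ContinuousOn (deriv y) (Ioi (2 * M)) ∧
  y (4 * M) = y₀ ∧
  ∀ r ∈ Ioi (2 * M),
    HasDerivAt y
      (-(1 - (2 / r) * (M + mFun M l L₀ δ r₀ Φ χ y r))⁻¹ *
        ((M + mFun M l L₀ δ r₀ Φ χ y r) / r ^ 2 +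
          4 * π * r * pFun l L₀ δ r₀ Φ χ y r)) r

/-- A Landau-Kolmogorov type bound: a smooth function vanishing on a half-line has its derivative
controlled by a power of its size that is as close to `1` as desired. -/
theorem exists_deriv_bound_rpow (n : ℕ) : ∀ (f : ℝ → ℝ), ContDiff ℝ (⊤ : ℕ∞) f →
    (∀ x ≤ 0, f x = 0) → ∀ T : ℝ, ∃ C : ℝ, 1 ≤ C ∧ ∀ x ≤ T, ∀ A : ℝ, 0 ≤ A →
      (∀ s ≤ x, |f s| ≤ A) → |deriv f x| ≤ C * A ^ (1 - 1 / ((n : ℝ) + 1)) := by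
  have hzero : ∀ f : ℝ → ℝ, ContDiff ℝ (⊤ : ℕ∞) f → (∀ x ≤ 0, f x = 0) →
      ∀ x ≤ 0, deriv f x = 0 := by
    intro f hf h0
    have hlt : ∀ x < 0, deriv f x = 0 := by
      intro x hx
      have : f =ᶠ[𝓝 x] fun _ => 0 := by
        filter_upwards [Iio_mem_nhds hx] with s hs using h0 s (le_of_lt hs)
      rw [this.deriv_eq]; simp
    have hc : Continuous (deriv f) := hf.continuous_deriv (by simp)
    intro x hx
    rcases hx.lt_or_eq with h | rfl
    · exact hlt x h
    · have hcl : IsClosed {x | deriv f x = 0} := isClosed_eq hc continuous_const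
      have : closure (Iio (0:ℝ)) ⊆ {x | deriv f x = 0} :=
        hcl.closure_subset_iff.2 (fun x hx => hlt x hx)
      exact this (by rw [closure_Iio]; simp)
  induction n with
  | zero =>
    intro f hf h0 T
    have hc : Continuous (deriv f) := hf.continuous_deriv (by simp)
    obtain ⟨C, hC⟩ := (isCompact_Icc (a := (0:ℝ)) (b := T)).exists_bound_of_continuousOn
      hc.continuousOn
    refine ⟨max C 1, le_max_right _ _, fun x hx A hA _ => ?_⟩
    simp only [Nat.cast_zero, zero_add, div_one, sub_self, rpow_zero, mul_one]
    rcases le_total x 0 with h | h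
    · rw [hzero f hf h0 x h]; simp
    · exact (hC x ⟨h, hx⟩).trans (le_max_left _ _)
  | succ n ih =>
    intro f hf h0 T
    have hf' : ContDiff ℝ (⊤ : ℕ∞) (deriv f) := (contDiff_infty_iff_deriv.1 hf).2
    have hd0 := hzero f hf h0
    obtain ⟨C, hC1, hC⟩ := ih (deriv f) hf' hd0 T
    set γ : ℝ := 1 - 1 / ((n : ℝ) + 1) with hγ
    have hn1 : (0:ℝ) < (n : ℝ) + 1 := by positivity
    have hn2 : (0:ℝ) < (n : ℝ) + 2 := by positivity
    have h2γ : 2 - γ = ((n : ℝ) + 2) / ((n : ℝ) + 1) := by rw [hγ]; field_simp; ring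
    have hexp : 1 - 1 / (((n + 1 : ℕ) : ℝ) + 1) = (2 - γ)⁻¹ := by
      rw [h2γ]; push_cast; field_simp; ring
    have h2γpos : 0 < 2 - γ := by rw [h2γ]; positivity
    rw [hexp]
    have hDpos : (0:ℝ) ≤ 8 * C := by linarith
    have hD1 : (1:ℝ) ≤ 8 * C := by linarith
    refine ⟨(8 * C) ^ (2 - γ)⁻¹, one_le_rpow hD1 (by positivity), fun x hx A hA hfA => ?_⟩
    rcases le_total x 0 with hx0 | hx0
    · rw [hd0 x hx0]; simp; positivity
    have hdc : Continuous (deriv f) := hf.continuous_deriv (by simp)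
    obtain ⟨t, ht, htmax⟩ := (isCompact_Icc (a := (0:ℝ)) (b := x)).exists_isMaxOn
      ⟨x, hx0, le_rfl⟩ (hdc.abs.continuousOn)
    set A' := |deriv f t| with hA'
    have hA'0 : 0 ≤ A' := abs_nonneg _
    have hall : ∀ s ≤ x, |deriv f s| ≤ A' := by
      intro s hs
      rcases le_total s 0 with h | h
      · rw [hd0 s h]; simpa using hA'0
      · exact htmax ⟨h, hs⟩
    rw [← mul_rpow hDpos hA]
    refine (hall x le_rfl).trans ?_
    rcases hA'0.lt_or_eq with hpos | hz
    swap
    · rw [← hz]; positivity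
    set B := C * A' ^ γ with hB
    have hBpos : 0 < B := by positivity
    have hB2 : ∀ s ≤ x, |deriv (deriv f) s| ≤ B := fun s hs =>
      hC s (hs.trans hx) A' hA'0 (fun u hu => hall u (hu.trans hs))
    set h := A' / (2 * B) with hh
    have hhpos : 0 < h := by positivity
    obtain ⟨ξ, hξ, hξe⟩ := exists_deriv_eq_slope f (a := t - h) (b := t) (by linarith)
      hf.continuous.continuousOn (hf.differentiable (by simp)).differentiableOn
    obtain ⟨ζ, hζ, hζe⟩ := exists_deriv_eq_slope (deriv f) (a := ξ) (b := t) hξ.2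
      hdc.continuousOn (hf'.differentiable (by simp)).differentiableOn
    have e1 : f t - f (t - h) = h * deriv f ξ := by
      rw [hξe, sub_sub_cancel]; field_simp
    have e2 : deriv f t - deriv f ξ = (t - ξ) * deriv (deriv f) ζ := by
      rw [hζe]; have : t - ξ ≠ 0 := by linarith [hξ.2]
      field_simp
    have b2 : |deriv f t - deriv f ξ| ≤ A' / 2 := by
      rw [e2, abs_mul, abs_of_pos (by linarith [hξ.2])]
      have : (t - ξ) * |deriv (deriv f) ζ| ≤ h * B := by
        apply mul_le_mul (by linarith [hξ.1]) (hB2 ζ (by linarith [hζ.2, ht.2])) (abs_nonneg _)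
          hhpos.le
      refine this.trans (le_of_eq ?_)
      rw [hh]; field_simp
    have b3 : A' / 2 ≤ |deriv f ξ| := by
      have := abs_sub_abs_le_abs_sub (deriv f t) (deriv f ξ)
      linarith
    have b1 : h * |deriv f ξ| ≤ 2 * A := by
      have h0 : h * |deriv f ξ| = |h * deriv f ξ| := by rw [abs_mul, abs_of_pos hhpos]
      rw [h0, ← e1]
      have h1 := hfA t ht.2
      have h2 := hfA (t - h) (by linarith [ht.2])
      have := abs_sub (f t) (f (t - h))
      linarith
    have b4 : A' ^ 2 ≤ 8 * A * B := by
      have : h * (A' / 2) ≤ 2 * A := (mul_le_mul_of_nonneg_left b3 hhpos.le).trans b1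
      rw [hh] at this
      have h4 : A' / (2 * B) * (A' / 2) = A' ^ 2 / (4 * B) := by field_simp; ring
      rw [h4, div_le_iff₀ (by positivity)] at this
      linarith
    have b5 : A' ^ (2 - γ) ≤ 8 * C * A := by
      rw [rpow_sub hpos, div_le_iff₀ (by positivity)]
      calc A' ^ (2:ℝ) = A' ^ 2 := by norm_cast
        _ ≤ 8 * A * B := b4
        _ = 8 * C * A * A' ^ γ := by rw [hB]; ring
    calc A' = (A' ^ (2 - γ)) ^ (2 - γ)⁻¹ := by
          rw [← rpow_mul hA'0, mul_inv_cancel₀ h2γpos.ne', rpow_one]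
      _ ≤ (8 * C * A) ^ (2 - γ)⁻¹ := rpow_le_rpow (by positivity) b5 (by positivity)

/-- The primitive of a nonnegative smooth function vanishing on the negative half-line controls
that function up to an arbitrarily small loss in the exponent. -/
theorem exists_le_integral_rpow {χ : ℝ → ℝ} (hχ : ContDiff ℝ (⊤ : ℕ∞) χ)
    (hχ0 : ∀ x ≤ 0, χ x = 0) (hχn : ∀ x, 0 ≤ χ x) (n : ℕ) (T : ℝ) :
    ∃ C : ℝ, 1 ≤ C ∧ ∀ x ≤ T,
      χ x ≤ C * (∫ s in (0:ℝ)..x, χ s) ^ (1 - 1 / ((n : ℝ) + 1)) := by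
  have hder : ∀ x, HasDerivAt (fun x => ∫ s in (0:ℝ)..x, χ s) (χ x) x := fun x =>
    hχ.continuous.integral_hasStrictDerivAt 0 x |>.hasDerivAt
  have hde : deriv (fun x => ∫ s in (0:ℝ)..x, χ s) = χ := funext fun x => (hder x).deriv
  have hmono : Monotone (fun x => ∫ s in (0:ℝ)..x, χ s) :=
    monotone_of_deriv_nonneg (fun x => (hder x).differentiableAt) (fun x => by rw [hde]; exact hχn x)
  have hz : ∀ x ≤ 0, (∫ s in (0:ℝ)..x, χ s) = 0 := by
    intro x hx
    rw [intervalIntegral.integral_congr (g := fun _ => 0)]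
    · simp
    · intro s hs
      rw [uIcc_of_ge hx] at hs
      exact hχ0 s hs.2
  have hnn : ∀ x, 0 ≤ ∫ s in (0:ℝ)..x, χ s := by
    intro x
    rcases le_total x 0 with h | h
    · rw [hz x h]
    · exact intervalIntegral.integral_nonneg h (fun s _ => hχn s)
  have hsm : ContDiff ℝ (⊤ : ℕ∞) (fun x => ∫ s in (0:ℝ)..x, χ s) :=
    contDiff_infty_iff_deriv.2 ⟨fun x => (hder x).differentiableAt, by rw [hde]; exact hχ⟩
  obtain ⟨C, hC1, hC⟩ := exists_deriv_bound_rpow n _ hsm hz T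
  refine ⟨C, hC1, fun x hx => ?_⟩
  have := hC x hx _ (hnn x) (fun s hs => by
    rw [abs_of_nonneg (hnn s)]; exact hmono hs)
  rw [hde, abs_of_nonneg (hχn x)] at this
  exact this

theorem cConst_pos {l : ℝ} (hl : -(1/2) < l) : 0 < cConst l := by
  have hint : IntervalIntegrable (fun s : ℝ => s ^ l / Real.sqrt (1 - s)) volume 0 1 := by
    have h := (Complex.betaIntegral_convergent (u := ((l + 1 : ℝ) : ℂ)) (v := ((1/2 : ℝ) : ℂ))
      (by rw [Complex.ofReal_re]; linarith) (by rw [Complex.ofReal_re]; norm_num)).norm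
    refine h.congr_uIoo ?_
    intro s hs
    rw [uIoo_of_le zero_le_one] at hs
    have h1 : 0 < 1 - s := by linarith [hs.2]
    have e1 : ((s : ℂ)) ^ (((l + 1 : ℝ) : ℂ) - 1) = ((s ^ l : ℝ) : ℂ) := by
      rw [Complex.ofReal_cpow hs.1.le]; push_cast; congr 1; ring
    have e2 : (1 - (s : ℂ)) ^ (((1/2 : ℝ) : ℂ) - 1) = (((1 - s) ^ (-(1/2) : ℝ) : ℝ) : ℂ) := by
      rw [Complex.ofReal_cpow h1.le]; push_cast; congr 1; norm_num
    simp only [e1, e2, norm_mul, Complex.norm_real, Real.norm_eq_abs]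
    rw [abs_of_nonneg (rpow_nonneg hs.1.le _), abs_of_nonneg (rpow_nonneg h1.le _),
      rpow_neg h1.le, ← sqrt_eq_rpow, div_eq_mul_inv]
  refine intervalIntegral_pos_of_pos_on hint (fun s hs => ?_) zero_lt_one
  have h1 : 0 < 1 - s := by linarith [hs.2]
  have := rpow_pos_of_pos hs.1 l
  positivity

theorem dConst_pos {l : ℝ} (hl : -(1/2) < l) : 0 < dConst l := by
  have hint : IntervalIntegrable (fun s : ℝ => s ^ l * Real.sqrt (1 - s)) volume 0 1 :=
    (intervalIntegrable_rpow' (by linarith)).mul_continuousOn (by fun_prop)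
  refine intervalIntegral_pos_of_pos_on hint (fun s hs => ?_) zero_lt_one
  have h1 : 0 < 1 - s := by linarith [hs.2]
  have := rpow_pos_of_pos hs.1 l
  positivity

theorem hasDerivAt_max_zero_rpow {s : ℝ} (hs : 1 < s) (t : ℝ) :
    HasDerivAt (fun t : ℝ => max t 0 ^ s) (s * max t 0 ^ (s - 1)) t := by
  rcases lt_trichotomy t 0 with ht | rfl | ht
  · have : (fun t : ℝ => max t 0 ^ s) =ᶠ[𝓝 t] fun _ => 0 := by
      filter_upwards [Iio_mem_nhds ht] with x hx
      rw [max_eq_right (le_of_lt hx), zero_rpow (by linarith)]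
    rw [max_eq_right ht.le, zero_rpow (by linarith), mul_zero]
    exact (hasDerivAt_const t (0:ℝ)).congr_of_eventuallyEq this
  · have h0 : s * max (0:ℝ) 0 ^ (s - 1) = 0 := by
      rw [max_self, zero_rpow (by linarith), mul_zero]
    rw [h0]
    have hl : HasDerivWithinAt (fun t : ℝ => max t 0 ^ s) 0 (Iic 0) 0 :=
      (hasDerivWithinAt_const (0:ℝ) (Iic 0) (0:ℝ)).congr
        (fun x hx => by rw [max_eq_right hx, zero_rpow (by linarith)])
        (by rw [max_self, zero_rpow (by linarith)])
    have hr : HasDerivWithinAt (fun t : ℝ => max t 0 ^ s) 0 (Ici 0) 0 := by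
      have := (Real.hasDerivAt_rpow_const (x := 0) (p := s) (Or.inr hs.le)).hasDerivWithinAt
        (s := Ici 0)
      rw [zero_rpow (by linarith), mul_zero] at this
      exact this.congr (fun x hx => by rw [max_eq_left hx]) (by rw [max_self])
    have := hl.union hr
    rwa [Iic_union_Ici, hasDerivWithinAt_univ] at this
  · have : (fun t : ℝ => max t 0 ^ s) =ᶠ[𝓝 t] fun t => t ^ s := by
      filter_upwards [Ioi_mem_nhds ht] with x hx
      rw [max_eq_left (le_of_lt hx)]
    rw [max_eq_left ht.le]
    exact (Real.hasDerivAt_rpow_const (Or.inl ht.ne')).congr_of_eventuallyEq this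

/-- The moment `∫₀¹ g(α) (u (1-α)² - B)₊^s dα`. -/
def truncMoment (g : ℝ → ℝ) (s u B : ℝ) : ℝ :=
  ∫ α in (0:ℝ)..1, g α * max (u * (1 - α) ^ 2 - B) 0 ^ s

section truncMoment

variable {g : ℝ → ℝ} {K s : ℝ}

theorem continuous_max_zero_rpow (hs : 0 < s) : Continuous (fun t : ℝ => max t 0 ^ s) :=
  (continuous_id.max continuous_const).rpow_const (fun _ => Or.inr hs.le)

theorem measurable_truncMoment_integrand (hg : Measurable g) (hs : 0 < s) (u B : ℝ) :
    Measurable (fun α => g α * max (u * (1 - α) ^ 2 - B) 0 ^ s) :=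
  hg.mul ((continuous_max_zero_rpow hs).comp
    (by fun_prop : Continuous fun α : ℝ => u * (1 - α) ^ 2 - B)).measurable

theorem norm_truncMoment_integrand_le (hgK : ∀ α ∈ Icc (0:ℝ) 1, |g α| ≤ K) (hs : 0 < s)
    {u B V : ℝ} (hV : |u| + |B| ≤ V) {α : ℝ} (hα : α ∈ Icc (0:ℝ) 1) :
    ‖g α * max (u * (1 - α) ^ 2 - B) 0 ^ s‖ ≤ K * V ^ s := by
  have hV0 : 0 ≤ V := le_trans (by positivity) hV
  have hm : max (u * (1 - α) ^ 2 - B) 0 ≤ V := by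
    refine max_le ?_ hV0
    have h1 : (1 - α) ^ 2 ≤ 1 := by nlinarith [hα.1, hα.2]
    have h2 : u * (1 - α) ^ 2 ≤ |u| * 1 :=
      mul_le_mul (le_abs_self u) h1 (sq_nonneg _) (abs_nonneg u)
    linarith [neg_abs_le B]
  rw [norm_mul, Real.norm_eq_abs, Real.norm_eq_abs, abs_of_nonneg (rpow_nonneg (le_max_right _ _) s)]
  exact mul_le_mul (hgK α hα) (rpow_le_rpow (le_max_right _ _) hm hs.le)
    (rpow_nonneg (le_max_right _ _) s) ((abs_nonneg _).trans (hgK α hα))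

theorem intervalIntegrable_truncMoment (hg : Measurable g) (hgK : ∀ α ∈ Icc (0:ℝ) 1, |g α| ≤ K)
    (hs : 0 < s) (u B : ℝ) {a b : ℝ} (ha : a ∈ Icc (0:ℝ) 1) (hb : b ∈ Icc (0:ℝ) 1) :
    IntervalIntegrable (fun α => g α * max (u * (1 - α) ^ 2 - B) 0 ^ s) volume a b := by
  refine (intervalIntegrable_const (c := K * (|u| + |B|) ^ s)).mono_fun'
    (measurable_truncMoment_integrand hg hs u B).aestronglyMeasurable ?_
  refine (ae_restrict_iff' measurableSet_uIoc).2 (Eventually.of_forall fun α hα => ?_)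
  exact norm_truncMoment_integrand_le hgK hs le_rfl
    (uIcc_subset_Icc ha hb (uIoc_subset_uIcc hα))

theorem continuous_truncMoment (hg : Measurable g) (hgK : ∀ α ∈ Icc (0:ℝ) 1, |g α| ≤ K)
    (hs : 0 < s) : Continuous (fun q : ℝ × ℝ => truncMoment g s q.1 q.2) := by
  rw [continuous_iff_continuousAt]
  intro q₀
  refine intervalIntegral.continuousAt_of_dominated_interval
    (bound := fun _ => K * (|q₀.1| + |q₀.2| + 1) ^ s) ?_ ?_ intervalIntegrable_const ?_
  · exact Eventually.of_forall fun q =>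
      (measurable_truncMoment_integrand hg hs q.1 q.2).aestronglyMeasurable
  · have : ∀ᶠ q : ℝ × ℝ in 𝓝 q₀, |q.1| + |q.2| < |q₀.1| + |q₀.2| + 1 :=
      (by fun_prop : Continuous fun q : ℝ × ℝ => |q.1| + |q.2|).continuousAt.eventually_lt
        continuousAt_const (by simp)
    filter_upwards [this] with q hq
    refine Eventually.of_forall fun α hα => ?_
    rw [uIoc_of_le zero_le_one] at hα
    exact norm_truncMoment_integrand_le hgK hs hq.le (Ioc_subset_Icc_self hα)
  · refine Eventually.of_forall fun α _ => ?_
    exact (continuous_const.mul ((continuous_max_zero_rpow hs).comp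
      (by fun_prop : Continuous fun q : ℝ × ℝ => q.1 * (1 - α) ^ 2 - q.2))).continuousAt

theorem truncMoment_nonneg (hg0 : ∀ α, 0 ≤ g α) (u B : ℝ) : 0 ≤ truncMoment g s u B :=
  intervalIntegral.integral_nonneg zero_le_one fun α _ =>
    mul_nonneg (hg0 α) (rpow_nonneg (le_max_right _ _) s)

theorem truncMoment_le (hgK : ∀ α ∈ Icc (0:ℝ) 1, |g α| ≤ K)
    (hs : 0 < s) {u B : ℝ} (hu : 0 ≤ u) (hB : 0 ≤ B) :
    truncMoment g s u B ≤ K * u ^ s := by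
  have hK : 0 ≤ K := (abs_nonneg _).trans (hgK 0 (by simp))
  have h := intervalIntegral.norm_integral_le_of_norm_le_const (a := 0) (b := 1)
    (f := fun α => g α * max (u * (1 - α) ^ 2 - B) 0 ^ s) (C := K * u ^ s) (fun α hα => by
      rw [uIoc_of_le zero_le_one] at hα
      have hm : max (u * (1 - α) ^ 2 - B) 0 ≤ u := by
        refine max_le ?_ hu
        have h1 : (1 - α) ^ 2 ≤ 1 := by nlinarith [hα.1, hα.2]
        have := mul_le_mul_of_nonneg_left h1 hu
        linarith
      rw [norm_mul, Real.norm_eq_abs, Real.norm_eq_abs,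
        abs_of_nonneg (rpow_nonneg (le_max_right _ _) s)]
      exact mul_le_mul (hgK α (Ioc_subset_Icc_self hα)) (rpow_le_rpow (le_max_right _ _) hm hs.le)
        (rpow_nonneg (le_max_right _ _) s) hK)
  simp only [sub_zero, abs_one, mul_one] at h
  exact (le_abs_self _).trans h

theorem truncMoment_eq_zero (hs : 0 < s) {u B : ℝ} (hu : 0 ≤ u) (huB : u ≤ B) :
    truncMoment g s u B = 0 := by
  unfold truncMoment
  rw [intervalIntegral.integral_congr (g := fun _ => 0)]
  · simp
  · intro α hα
    rw [uIcc_of_le zero_le_one] at hα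
    have h1 : (1 - α) ^ 2 ≤ 1 := by nlinarith [hα.1, hα.2]
    have := mul_le_mul_of_nonneg_left h1 hu
    simp only
    rw [max_eq_right (by linarith), zero_rpow hs.ne', mul_zero]

theorem exists_le_truncMoment (hg : Measurable g) (hgK : ∀ α ∈ Icc (0:ℝ) 1, |g α| ≤ K)
    (hg0 : ∀ α, 0 ≤ g α) {α₀ : ℝ} (hα₀ : 0 < α₀) (hgpos : ∀ α ∈ Ioo 0 α₀, 0 < g α)
    (hs : 0 < s) : ∃ c : ℝ, 0 < c ∧ ∀ u B : ℝ, 0 ≤ u → 8 * B ≤ u →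
      c * u ^ s ≤ truncMoment g s u B := by
  set α₁ := min α₀ (1/2) with hα₁
  have hα₁0 : 0 < α₁ := lt_min hα₀ (by norm_num)
  have hα₁h : α₁ ≤ 1/2 := min_le_right _ _
  have hgi : IntervalIntegrable g volume 0 α₁ := by
    refine (intervalIntegrable_const (c := K)).mono_fun' hg.aestronglyMeasurable ?_
    refine (ae_restrict_iff' measurableSet_uIoc).2 (Eventually.of_forall fun α hα => ?_)
    rw [uIoc_of_le hα₁0.le] at hα
    exact hgK α ⟨hα.1.le, by linarith [hα.2]⟩
  have hpos : 0 < ∫ α in (0:ℝ)..α₁, g α :=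
    intervalIntegral_pos_of_pos_on hgi
      (fun α hα => hgpos α ⟨hα.1, hα.2.trans_le (min_le_left _ _)⟩) hα₁0
  refine ⟨(∫ α in (0:ℝ)..α₁, g α) * (1/8 : ℝ) ^ s, by positivity, fun u B hu hB => ?_⟩
  have hmem : α₁ ∈ Icc (0:ℝ) 1 := ⟨hα₁0.le, by linarith⟩
  have hsplit := intervalIntegral.integral_add_adjacent_intervals
    (intervalIntegrable_truncMoment hg hgK hs u B (by simp : (0:ℝ) ∈ Icc (0:ℝ) 1) hmem)
    (intervalIntegrable_truncMoment hg hgK hs u B hmem (by simp : (1:ℝ) ∈ Icc (0:ℝ) 1))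
  unfold truncMoment
  rw [← hsplit]
  have h2 : 0 ≤ ∫ α in α₁..1, g α * max (u * (1 - α) ^ 2 - B) 0 ^ s :=
    intervalIntegral.integral_nonneg hmem.2 fun α _ =>
      mul_nonneg (hg0 α) (rpow_nonneg (le_max_right _ _) s)
  have h1 : (∫ α in (0:ℝ)..α₁, g α) * (1/8 : ℝ) ^ s * u ^ s ≤
      ∫ α in (0:ℝ)..α₁, g α * max (u * (1 - α) ^ 2 - B) 0 ^ s := by
    rw [mul_assoc, ← mul_rpow (by norm_num) hu, ← intervalIntegral.integral_mul_const]
    refine intervalIntegral.integral_mono_on hα₁0.le (hgi.mul_const _)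
      (intervalIntegrable_truncMoment hg hgK hs u B (by simp : (0:ℝ) ∈ Icc (0:ℝ) 1) hmem) ?_
    intro α hα
    refine mul_le_mul_of_nonneg_left (rpow_le_rpow (by positivity) ?_ hs.le) (hg0 α)
    refine le_trans ?_ (le_max_left _ _)
    have h3 : (1/4 : ℝ) ≤ (1 - α) ^ 2 := by nlinarith [hα.1, hα.2]
    have := mul_le_mul_of_nonneg_left h3 hu
    linarith
  linarith

theorem hasDerivAt_truncMoment (hg : Measurable g) (hgK : ∀ α ∈ Icc (0:ℝ) 1, |g α| ≤ K)
    (hs : 1 < s) {u B u' B' : ℝ → ℝ} {r₀ : ℝ}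
    (hu : ∀ᶠ r in 𝓝 r₀, HasDerivAt u (u' r) r) (hB : ∀ᶠ r in 𝓝 r₀, HasDerivAt B (B' r) r)
    (hu' : ContinuousAt u' r₀) (hB' : ContinuousAt B' r₀) :
    HasDerivAt (fun r => truncMoment g s (u r) (B r))
      (s * (u' r₀ * truncMoment (fun α => g α * (1 - α) ^ 2) (s - 1) (u r₀) (B r₀) -
        B' r₀ * truncMoment g (s - 1) (u r₀) (B r₀))) r₀ := by
  have hs1 : 0 < s - 1 := by linarith
  have hs0 : 0 < s := by linarith
  have hK : 0 ≤ K := (abs_nonneg _).trans (hgK 0 (by simp))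
  have hg2 : Measurable (fun α => g α * (1 - α) ^ 2) := by fun_prop
  have hsq : ∀ α ∈ Icc (0:ℝ) 1, (1 - α) ^ 2 ≤ 1 := fun α hα => by nlinarith [hα.1, hα.2]
  have hg2K : ∀ α ∈ Icc (0:ℝ) 1, |g α * (1 - α) ^ 2| ≤ K := by
    intro α hα
    rw [abs_mul, abs_of_nonneg (sq_nonneg (1 - α))]
    calc |g α| * (1 - α) ^ 2 ≤ K * 1 := mul_le_mul (hgK α hα) (hsq α hα) (sq_nonneg _) hK
      _ = K := mul_one K
  have huc : ContinuousAt u r₀ := hu.self_of_nhds.continuousAt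
  have hBc : ContinuousAt B r₀ := hB.self_of_nhds.continuousAt
  set V := |u r₀| + |B r₀| + 1 with hV
  set W := |u' r₀| + |B' r₀| + 1 with hW
  have hVe : ∀ᶠ r in 𝓝 r₀, |u r| + |B r| < V :=
    (huc.abs.add hBc.abs).eventually_lt continuousAt_const (by simp [hV])
  have hWe : ∀ᶠ r in 𝓝 r₀, |u' r| + |B' r| < W :=
    (hu'.abs.add hB'.abs).eventually_lt continuousAt_const (by simp [hW])
  have hall := (hu.and hB).and (hVe.and hWe)
  have key := intervalIntegral.hasDerivAt_integral_of_dominated_loc_of_deriv_le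
    (μ := volume) (a := 0) (b := 1)
    (F := fun r α => g α * max (u r * (1 - α) ^ 2 - B r) 0 ^ s)
    (F' := fun r α => s * (u' r * (g α * (1 - α) ^ 2 * max (u r * (1 - α) ^ 2 - B r) 0 ^ (s - 1)) -
      B' r * (g α * max (u r * (1 - α) ^ 2 - B r) 0 ^ (s - 1))))
    (x₀ := r₀) (bound := fun _ => s * (W * (K * V ^ (s - 1)))) hall
    (Eventually.of_forall fun r =>
      (measurable_truncMoment_integrand hg hs0 (u r) (B r)).aestronglyMeasurable)
    (intervalIntegrable_truncMoment hg hgK hs0 _ _ (by simp) (by simp))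
    (by
      have m1 := measurable_truncMoment_integrand hg2 hs1 (u r₀) (B r₀)
      have m2 := measurable_truncMoment_integrand hg hs1 (u r₀) (B r₀)
      exact (((m1.const_mul _).sub (m2.const_mul _)).const_mul s).aestronglyMeasurable)
    (Eventually.of_forall fun α hα r hr => by
      rw [uIoc_of_le zero_le_one] at hα
      have hα' := Ioc_subset_Icc_self hα
      have hrV := hr.2.1.le
      have hrW := hr.2.2.le
      have n1 := norm_truncMoment_integrand_le hg2K hs1 hrV hα'
      have n2 := norm_truncMoment_integrand_le hgK hs1 hrV hα'
      rw [norm_mul, Real.norm_of_nonneg hs0.le]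
      refine mul_le_mul_of_nonneg_left ((norm_sub_le _ _).trans ?_) hs0.le
      rw [norm_mul (u' r), norm_mul (B' r), Real.norm_eq_abs (u' r), Real.norm_eq_abs (B' r)]
      have hKV : 0 ≤ K * V ^ (s - 1) := (norm_nonneg _).trans n2
      calc _ ≤ |u' r| * (K * V ^ (s - 1)) + |B' r| * (K * V ^ (s - 1)) :=
            add_le_add (mul_le_mul_of_nonneg_left n1 (abs_nonneg _))
              (mul_le_mul_of_nonneg_left n2 (abs_nonneg _))
        _ = (|u' r| + |B' r|) * (K * V ^ (s - 1)) := by ring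
        _ ≤ _ := mul_le_mul_of_nonneg_right hrW hKV)
    intervalIntegrable_const
    (Eventually.of_forall fun α _ r hr => by
      have h1 := hr.1.1
      have h2 := hr.1.2
      have := ((hasDerivAt_max_zero_rpow hs (u r * (1 - α) ^ 2 - B r)).comp r
        ((h1.mul_const ((1 - α) ^ 2)).sub h2)).const_mul (g α)
      refine (this.congr_deriv ?_)
      ring)
  refine key.2.congr_deriv ?_
  rw [intervalIntegral.integral_const_mul, intervalIntegral.integral_sub,
    intervalIntegral.integral_const_mul, intervalIntegral.integral_const_mul]
  · rfl
  · exact (intervalIntegrable_truncMoment hg2 hg2K hs1 _ _ (by simp) (by simp)).const_mul _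
  · exact (intervalIntegrable_truncMoment hg hgK hs1 _ _ (by simp) (by simp)).const_mul _

end truncMoment

/-- The reduced field equations on `[a, b]` for the quantity `D = 1 - 2 m / r` and the potential
`y`, together with two-sided bounds on the density and the pressure generated by the cut-off
`χ (· - a)`. -/
structure ShellSystem (a b w C₁ c₁ c₀ y₁ δ : ℝ) (χ D y ρ p : ℝ → ℝ) : Prop where
  hasDerivAt_y : ∀ r ∈ Icc a b,
    HasDerivAt y (-((1 - D r) / (2 * r) + 4 * π * r * p r) / D r) r
  hasDerivAt_D : ∀ r ∈ Icc a b, HasDerivAt D ((1 - D r) / r - 8 * π * r * ρ r) r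
  D_pos : ∀ r ∈ Icc a b, 0 < D r
  D_le : ∀ r ∈ Icc a b, D r ≤ 1 - c₀
  ρ_nonneg : ∀ r ∈ Icc a b, 0 ≤ ρ r
  p_nonneg : ∀ r ∈ Icc a b, 0 ≤ p r
  ρ_le : ∀ r ∈ Icc a b, ρ r ≤ C₁ * (δ * χ (r - a) * exp (w * y r))
  p_le : ∀ r ∈ Icc a b, p r ≤ C₁ * (δ * χ (r - a) * exp (w * y r))
  le_ρ : ∀ r ∈ Icc a b, y₁ ≤ y r → c₁ * (δ * χ (r - a) * exp (w * y r)) ≤ ρ r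
  le_p : ∀ r ∈ Icc a b, y₁ ≤ y r → c₁ * (δ * χ (r - a) * exp (w * y r)) ≤ p r

namespace ShellSystem

variable {a b w C₁ c₁ c₀ y₁ δ : ℝ} {χ D y ρ p : ℝ → ℝ}

theorem antitoneOn_y (h : ShellSystem a b w C₁ c₁ c₀ y₁ δ χ D y ρ p) (ha : 0 < a) (hc₀ : 0 < c₀) :
    AntitoneOn y (Icc a b) := by
  refine antitoneOn_of_deriv_nonpos (convex_Icc a b)
    (fun r hr => (h.hasDerivAt_y r hr).continuousAt.continuousWithinAt)
    (fun r hr => (h.hasDerivAt_y r (interior_subset hr)).differentiableAt.differentiableWithinAt)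
    (fun r hr => ?_)
  have hr' := interior_subset hr
  rw [(h.hasDerivAt_y r hr').deriv]
  have hr0 : 0 < r := ha.trans_le hr'.1
  have h1 : 0 ≤ (1 - D r) / (2 * r) := div_nonneg (by linarith [h.D_le r hr']) (by positivity)
  have h2 : 0 ≤ 4 * π * r * p r := mul_nonneg (by positivity) (h.p_nonneg r hr')
  exact div_nonpos_of_nonpos_of_nonneg (by linarith) (h.D_pos r hr').le

theorem integral_mul_exp_le (h : ShellSystem a b w C₁ c₁ c₀ y₁ δ χ D y ρ p)
    (ha : 0 < a) (hw : 0 < w) (hc₁ : 0 < c₁) (hc₀ : 0 < c₀) (hδ : 0 < δ)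
    (hχ : Continuous χ) (hχn : ∀ x, 0 ≤ χ x) {r : ℝ} (hr : r ∈ Icc a b) (hy : y₁ ≤ y r) :
    (∫ s in (0:ℝ)..(r - a), χ s) * (δ * exp (w * y r)) ≤ b / (8 * π * a ^ 2 * c₁) := by
  set E := δ * exp (w * y r) with hE
  have hEpos : 0 < E := by positivity
  set X : ℝ → ℝ := fun r => ∫ s in (0:ℝ)..(r - a), χ s with hX
  have hXd : ∀ s, HasDerivAt X (χ (s - a)) s := fun s => by
    have := (hχ.integral_hasStrictDerivAt 0 (s - a)).hasDerivAt.comp s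
      ((hasDerivAt_id s).sub_const a)
    rw [mul_one] at this
    exact this
  have hsub : Icc a r ⊆ Icc a b := Icc_subset_Icc_right hr.2
  have hanti : AntitoneOn (fun s => D s + 8 * π * a * c₁ * E * X s - s / a) (Icc a r) := by
    have hd : ∀ s ∈ Icc a r, HasDerivAt (fun s => D s + 8 * π * a * c₁ * E * X s - s / a)
        ((1 - D s) / s - 8 * π * s * ρ s + 8 * π * a * c₁ * E * χ (s - a) - 1 / a) s := fun s hs =>
      ((h.hasDerivAt_D s (hsub hs)).add ((hXd s).const_mul _)).sub ((hasDerivAt_id s).div_const a)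
    refine antitoneOn_of_deriv_nonpos (convex_Icc a r)
      (fun s hs => (hd s hs).continuousAt.continuousWithinAt)
      (fun s hs => (hd s (interior_subset hs)).differentiableAt.differentiableWithinAt)
      (fun s hs => ?_)
    have hs' := interior_subset hs
    rw [(hd s hs').deriv]
    have hs0 : 0 < s := ha.trans_le hs'.1
    have hys : y r ≤ y s := h.antitoneOn_y ha hc₀ (hsub hs') hr hs'.2
    have h1 : (1 - D s) / s ≤ 1 / a :=
      div_le_div₀ zero_le_one (by linarith [h.D_pos s (hsub hs')]) ha hs'.1
    have h2 : c₁ * E * χ (s - a) ≤ ρ s := by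
      refine le_trans ?_ (h.le_ρ s (hsub hs') (hy.trans hys))
      have : exp (w * y r) ≤ exp (w * y s) := exp_le_exp.2 (by gcongr)
      calc c₁ * E * χ (s - a) = c₁ * (δ * χ (s - a)) * exp (w * y r) := by rw [hE]; ring
        _ ≤ c₁ * (δ * χ (s - a)) * exp (w * y s) :=
          mul_le_mul_of_nonneg_left this
            (mul_nonneg hc₁.le (mul_nonneg hδ.le (hχn _)))
        _ = _ := by ring
    have h3 : 8 * π * a * (c₁ * E * χ (s - a)) ≤ 8 * π * s * ρ s := by
      have h4 : 0 ≤ c₁ * E * χ (s - a) := mul_nonneg (by positivity) (hχn _)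
      refine mul_le_mul ?_ h2 h4 (by positivity)
      exact mul_le_mul_of_nonneg_left hs'.1 (by positivity)
    linarith
  have key := hanti (left_mem_Icc.2 hr.1) (right_mem_Icc.2 hr.1) hr.1
  have hXa : X a = 0 := by simp [hX]
  have hDa := h.D_le a (left_mem_Icc.2 (hr.1.trans hr.2))
  have hDr := h.D_pos r hr
  simp only [hXa, mul_zero, add_zero, div_self ha.ne'] at key
  have h5 : 8 * π * a * c₁ * E * X r ≤ b / a := by
    have : r / a ≤ b / a := by gcongr; exact hr.2
    linarith
  have h6 : b / (8 * π * a ^ 2 * c₁) = b / a / (8 * π * a * c₁) := by field_simp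
  rw [h6, le_div_iff₀ (by positivity)]
  linarith

set_option maxHeartbeats 2000000 in
/-- Key lower bound: the smoothness of the cut-off prevents `D` from becoming too small compared
with the amount of cut-off mass `X` already crossed. -/
theorem exists_rpow_le_D (ha : 0 < a) (hab : a < b) (hw : 0 < w) (hC₁ : 0 < C₁) (hc₁ : 0 < c₁)
    (hc₀ : 0 < c₀) (hχ : ContDiff ℝ (⊤ : ℕ∞) χ) (hχ0 : ∀ x ≤ 0, χ x = 0) (hχn : ∀ x, 0 ≤ χ x) :
    ∃ β κ C c δ₁ : ℝ, 0 < c ∧ 0 < δ₁ ∧ 0 ≤ C ∧ κ * (w / 2 + 1) ≤ 1 - β ∧ β < 1 ∧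
      (∀ r ≤ b, χ (r - a) ≤ C * (∫ s in (0:ℝ)..(r - a), χ s) ^ (1 - β)) ∧
      ∀ δ, 0 < δ → δ < δ₁ → ∀ D y ρ p : ℝ → ℝ, ShellSystem a b w C₁ c₁ c₀ y₁ δ χ D y ρ p →
        ∀ r ∈ Icc a b, 0 < (∫ s in (0:ℝ)..(r - a), χ s) →
          c * (∫ s in (0:ℝ)..(r - a), χ s) ^ κ ≤ D r := by
  have hb : 0 < b := ha.trans hab
  set k₀ := c₀ / b with hk₀
  have hk₀p : 0 < k₀ := by positivity
  set s₁ := k₀ / (16 * π * b * C₁) with hs₁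
  have hs₁p : 0 < s₁ := by positivity
  set θ := 2 * C₁ * (1 + s₁) / (s₁ * w * c₁) with hθ
  have hθp : 0 < θ := by positivity
  obtain ⟨n, hn⟩ := exists_nat_ge (2 * (1 + θ) * (w / 2 + 1))
  set β : ℝ := 1 / ((n : ℝ) + 1) with hβ
  have hn1 : (0:ℝ) < (n : ℝ) + 1 := by positivity
  have hβp : 0 < β := by positivity
  have hβw : β * (1 + θ) * (w / 2 + 1) ≤ 1 / 2 := by
    rw [hβ, mul_assoc, one_div, inv_mul_le_iff₀ hn1]
    linarith
  have hβh : β ≤ 1 / 2 := by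
    have h1 : 1 ≤ (1 + θ) * (w / 2 + 1) :=
      one_le_mul_of_one_le_of_one_le (by linarith) (by linarith)
    have := mul_le_mul_of_nonneg_left h1 hβp.le
    linarith
  set κ := β * (1 + θ) with hκ
  have hκp : 0 < κ := by positivity
  obtain ⟨C, hC1, hC⟩ := exists_le_integral_rpow hχ hχ0 hχn n (b - a)
  have hCp : 0 < C := by linarith
  set X : ℝ → ℝ := fun r => ∫ s in (0:ℝ)..(r - a), χ s with hX
  have hXd : ∀ s, HasDerivAt X (χ (s - a)) s := fun s => by
    have := (hχ.continuous.integral_hasStrictDerivAt 0 (s - a)).hasDerivAt.comp s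
      ((hasDerivAt_id s).sub_const a)
    rw [mul_one] at this
    exact this
  have hXc : Continuous X := continuous_iff_continuousAt.2 fun s => (hXd s).continuousAt
  have hXm : Monotone X := monotone_of_deriv_nonneg (fun s => (hXd s).differentiableAt)
    (fun s => by rw [(hXd s).deriv]; exact hχn _)
  have hXa : X a = 0 := by simp [hX]
  set Xm := X b + 1 with hXmdef
  have hXb : 0 ≤ X b := hXa ▸ hXm hab.le
  have hXm1 : 1 ≤ Xm := by linarith
  have hXm0 : 0 < Xm := by linarith
  set C₂ := b / (8 * π * a ^ 2 * c₁) with hC₂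
  have hC₂p : 0 < C₂ := by positivity
  set C₃ := (1 + s₁) * Xm ^ β + C * C₂ with hC₃
  have hC₃p : 0 < C₃ := by positivity
  set c₂ := min (k₀ / (4 * C * κ)) (w * k₀ / (4 * C)) with hc₂
  have hc₂p : 0 < c₂ := lt_min (by positivity) (by positivity)
  set c := c₂ / C₃ ^ θ with hc
  have hcp : 0 < c := by positivity
  set δ₁ := s₁ / (C * Xm ^ (1 - β) * exp (w * y₁)) with hδ₁
  have hδ₁p : 0 < δ₁ := by positivity
  refine ⟨β, κ, C, c, δ₁, hcp, hδ₁p, hCp.le, by linarith, by linarith, fun r hr =>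
    hC (r - a) (by linarith), fun δ hδ hδlt D y ρ p h r₂ hr₂ hX₂ => ?_⟩
  set σ : ℝ → ℝ := fun r => C * δ * (X r ^ (1 - β) * exp (w * y r)) with hσ
  have hXle : ∀ r ∈ Icc a b, X r ≤ Xm := fun r hr => (hXm hr.2).trans (by linarith)
  have hσ0 : ∀ r, 0 < X r → 0 < σ r := fun r hr => by positivity
  have hσy : ∀ r ∈ Icc a b, 0 < X r → s₁ ≤ σ r → y₁ ≤ y r := by
    intro r hr hXr hs
    by_contra! hlt
    have h1 : σ r < s₁ := by
      calc σ r ≤ C * δ * (Xm ^ (1 - β) * exp (w * y₁)) := by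
            have := hXle r hr
            have h3 : 0 ≤ 1 - β := by linarith
            simp only [hσ]; gcongr
        _ = δ * (C * Xm ^ (1 - β) * exp (w * y₁)) := by ring
        _ < δ₁ * (C * Xm ^ (1 - β) * exp (w * y₁)) := by gcongr
        _ = s₁ := by rw [hδ₁]; field_simp
    linarith
  have hσle : ∀ r ∈ Icc a b, 0 < X r → 1 + σ r ≤ C₃ * X r ^ (-β) := by
    intro r hr hXr
    have hone : 1 ≤ Xm ^ β * X r ^ (-β) := by
      rw [rpow_neg hXr.le, ← div_eq_mul_inv, one_le_div (by positivity)]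
      exact rpow_le_rpow hXr.le (hXle r hr) hβp.le
    have hnn : 0 < X r ^ (-β) := by positivity
    rcases le_total (σ r) s₁ with hs | hs
    · calc 1 + σ r ≤ (1 + s₁) * 1 := by linarith
        _ ≤ (1 + s₁) * (Xm ^ β * X r ^ (-β)) := by gcongr
        _ ≤ C₃ * X r ^ (-β) := by rw [hC₃]; linarith [mul_pos (mul_pos hCp hC₂p) hnn]
    · have hb2 := h.integral_mul_exp_le ha hw hc₁ hc₀ hδ hχ.continuous hχn hr (hσy r hr hXr hs)
      have e1 : σ r = C * (X r * (δ * exp (w * y r))) * X r ^ (-β) := by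
        have : X r ^ (1 - β) = X r * X r ^ (-β) := by
          rw [sub_eq_add_neg, rpow_add hXr, rpow_one]
        simp only [hσ, this]; ring
      have e2 : σ r ≤ C * C₂ * X r ^ (-β) := by
        rw [e1]; gcongr
      calc 1 + σ r ≤ 1 * (Xm ^ β * X r ^ (-β)) + C * C₂ * X r ^ (-β) := by linarith
        _ ≤ (1 + s₁) * (Xm ^ β * X r ^ (-β)) + C * C₂ * X r ^ (-β) := by gcongr; linarith
        _ = C₃ * X r ^ (-β) := by rw [hC₃]; ring
  have hcont : ContinuousOn D (Icc a b) := fun r hr =>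
    (h.hasDerivAt_D r hr).continuousAt.continuousWithinAt
  obtain ⟨rm, hrm, hmin⟩ := (isCompact_Icc (a := a) (b := b)).exists_isMinOn
    ⟨a, left_mem_Icc.2 hab.le⟩ hcont
  set d := D rm with hd
  have hdp : 0 < d := h.D_pos rm hrm
  set S := C * δ * (Xm ^ (1 - β) * exp (w * y a)) with hS
  have hSp : 0 < S := by positivity
  set f : ℝ → ℝ := fun r => κ * log (X r) + θ * log (1 + σ r) - log (D r) with hf
  set η := exp ((-log c - θ * log (1 + S) + log d) / κ) with hη
  have hηp : 0 < η := exp_pos _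
  obtain ⟨r₁, hr₁, hXr₁⟩ : ∃ r₁ ∈ Icc a r₂, X r₁ = min η (X r₂) := by
    have := intermediate_value_Icc hr₂.1 (hXc.continuousOn (s := Icc a r₂))
    exact this ⟨by rw [hXa]; exact (lt_min hηp hX₂).le, min_le_right _ _⟩
  have hX₁ : 0 < X r₁ := by rw [hXr₁]; exact lt_min hηp hX₂
  have hr₁b : r₁ ∈ Icc a b := ⟨hr₁.1, hr₁.2.trans hr₂.2⟩
  have hsub : Icc r₁ r₂ ⊆ Icc a b := Icc_subset_Icc hr₁.1 hr₂.2
  have hXpos : ∀ r ∈ Icc r₁ r₂, 0 < X r := fun r hr => hX₁.trans_le (hXm hr.1)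
  have hstart : f r₁ ≤ -log c := by
    have h1 : κ * log (X r₁) ≤ -log c - θ * log (1 + S) + log d := by
      have : log (X r₁) ≤ log η := log_le_log hX₁ (by rw [hXr₁]; exact min_le_left _ _)
      rw [hη, log_exp, le_div_iff₀ hκp] at this
      linarith
    have h2 : θ * log (1 + σ r₁) ≤ θ * log (1 + S) := by
      have h5 : σ r₁ ≤ S := by
        have h3 := hXle r₁ hr₁b
        have h4 := h.antitoneOn_y ha hc₀ (left_mem_Icc.2 hab.le) hr₁b hr₁.1
        have h6 : 0 ≤ 1 - β := by linarith
        simp only [hσ, hS]; gcongr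
      have := hσ0 r₁ hX₁
      gcongr
    have h3 : log d ≤ log (D r₁) := log_le_log hdp (hmin hr₁b)
    simp only [hf]; linarith
  set f' : ℝ → ℝ := fun r => κ * (χ (r - a) / X r) + θ * (σ r * ((1 - β) * (χ (r - a) / X r) +
    w * (-((1 - D r) / (2 * r) + 4 * π * r * p r) / D r)) / (1 + σ r)) -
    ((1 - D r) / r - 8 * π * r * ρ r) / D r with hf'
  have hfd : ∀ r ∈ Icc r₁ r₂, HasDerivAt f (f' r) r := by
    intro r hr
    have hXr := hXpos r hr
    have hσr := hσ0 r hXr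
    have d1 := ((hXd r).log hXr.ne').const_mul κ
    have d2 : HasDerivAt σ (σ r * ((1 - β) * (χ (r - a) / X r) +
        w * (-((1 - D r) / (2 * r) + 4 * π * r * p r) / D r))) r := by
      have := (((hXd r).rpow_const (p := 1 - β) (Or.inl hXr.ne')).mul
        (((h.hasDerivAt_y r (hsub hr)).const_mul w).exp)).const_mul (C * δ)
      refine this.congr_deriv ?_
      rw [rpow_sub_one hXr.ne']
      simp only [hσ]; ring
    have d3 := ((d2.const_add 1).log (by positivity)).const_mul θ
    have d4 := (h.hasDerivAt_D r (hsub hr)).log (h.D_pos r (hsub hr)).ne'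
    exact (d1.add d3).sub d4
  have hfence := image_le_of_deriv_right_lt_deriv_boundary' (f := f) (f' := f') (a := r₁) (b := r₂)
    (B := fun _ => -log c) (B' := fun _ => 0)
    (fun r hr => (hfd r hr).continuousAt.continuousWithinAt)
    (fun r hr => (hfd r (Ico_subset_Icc_self hr)).hasDerivWithinAt) hstart continuousOn_const
    (fun r _ => hasDerivWithinAt_const _ _ _) ?_ (right_mem_Icc.2 hr₁.2)
  · have hσr := hσ0 r₂ hX₂
    have h1 : 0 ≤ θ * log (1 + σ r₂) := mul_nonneg hθp.le (log_nonneg (by linarith))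
    have hD₂ := h.D_pos r₂ hr₂
    simp only [hf] at hfence
    rw [← log_le_log_iff (by positivity) hD₂, log_mul hcp.ne' (by positivity), log_rpow hX₂]
    linarith
  · intro r hr hfr
    have hr' := Ico_subset_Icc_self hr
    have hrb := hsub hr'
    have hXr := hXpos r hr'
    have hσr := hσ0 r hXr
    have hDr := h.D_pos r hrb
    have hr0 : 0 < r := ha.trans_le hrb.1
    have hpn := h.p_nonneg r hrb
    have hρn := h.ρ_nonneg r hrb
    have hDX : D r ≤ c₂ * X r ^ β := by
      have h1 : log (1 + σ r) ≤ log C₃ - β * log (X r) := by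
        have := log_le_log (by positivity) (hσle r hrb hXr)
        rw [log_mul hC₃p.ne' (by positivity), log_rpow hXr] at this
        linarith
      have h2 : log c = log c₂ - θ * log C₃ := by
        rw [hc, log_div hc₂p.ne' (by positivity), log_rpow hC₃p]
      rw [← log_le_log_iff hDr (by positivity), log_mul hc₂p.ne' (by positivity), log_rpow hXr]
      have h3 := mul_le_mul_of_nonneg_left h1 hθp.le
      simp only [hf] at hfr
      have h4 : κ * log (X r) = β * log (X r) + θ * (β * log (X r)) := by rw [hκ]; ring
      linarith
    set q := D r * (χ (r - a) / X r) with hq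
    have hχr := hχn (r - a)
    have hχle : χ (r - a) ≤ C * X r ^ (1 - β) := hC (r - a) (by linarith [hrb.2])
    have hq0 : 0 ≤ q := by positivity
    have hqC : q ≤ C * c₂ := by
      have h1 : χ (r - a) / X r ≤ C * X r ^ (-β) := by
        rw [div_le_iff₀ hXr]
        refine hχle.trans (le_of_eq ?_)
        rw [sub_eq_neg_add, rpow_add hXr, rpow_one]; ring
      calc q ≤ (c₂ * X r ^ β) * (C * X r ^ (-β)) := by rw [hq]; gcongr
        _ = C * c₂ * (X r ^ β * X r ^ (-β)) := by ring
        _ = C * c₂ := by rw [← rpow_add hXr, add_neg_cancel, rpow_zero, mul_one]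
    have hq1 : κ * q ≤ k₀ / 4 := by
      calc κ * q ≤ κ * (C * (k₀ / (4 * C * κ))) := by
            gcongr; exact hqC.trans (by gcongr; exact min_le_left _ _)
        _ = k₀ / 4 := by field_simp
    have hq2 : q ≤ w * k₀ / 4 := by
      calc q ≤ C * (w * k₀ / (4 * C)) := hqC.trans (by gcongr; exact min_le_right _ _)
        _ = w * k₀ / 4 := by field_simp
    have hk : k₀ ≤ (1 - D r) / r :=
      div_le_div₀ (by linarith [h.D_le r hrb]) (by linarith [h.D_le r hrb]) hr0 hrb.2
    have hDf : D r * f' r = κ * q + θ * (σ r / (1 + σ r)) * ((1 - β) * q -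
        w * ((1 - D r) / r / 2 + 4 * π * r * p r)) - (1 - D r) / r + 8 * π * r * ρ r := by
      have : 1 + σ r ≠ 0 := by positivity
      simp only [hf', hq]
      field_simp
      ring
    have hbr : (1 - β) * q - w * ((1 - D r) / r / 2 + 4 * π * r * p r) ≤
        -(4 * π * r * (w * p r)) := by
      have h1 : (1 - β) * q ≤ q := by linarith [mul_nonneg hβp.le hq0]
      have h2 := mul_le_mul_of_nonneg_left hk hw.le
      have h3 : 0 ≤ w * k₀ := by positivity
      linarith
    have hfrac : 0 ≤ θ * (σ r / (1 + σ r)) := by positivity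
    have hneg : D r * f' r < 0 := by
      rw [hDf]
      rcases le_or_gt (ρ r) (k₀ / (16 * π * b)) with hρ | hρ
      · have h1 : 8 * π * r * ρ r ≤ k₀ / 2 := by
          calc 8 * π * r * ρ r ≤ 8 * π * b * (k₀ / (16 * π * b)) := by
                gcongr; exact hrb.2
            _ = k₀ / 2 := by field_simp; norm_num
        have h2 : 0 ≤ 4 * π * r * (w * p r) := by positivity
        have h3 := mul_le_mul_of_nonneg_left (hbr.trans (neg_nonpos.2 h2)) hfrac
        linarith
      · have hρσ : ρ r ≤ C₁ * σ r := by
          refine (h.ρ_le r hrb).trans ?_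
          calc C₁ * (δ * χ (r - a) * exp (w * y r))
              ≤ C₁ * (δ * (C * X r ^ (1 - β)) * exp (w * y r)) := by gcongr
            _ = C₁ * σ r := by simp only [hσ]; ring
        have hs : s₁ ≤ σ r := by
          have e : s₁ = k₀ / (16 * π * b) / C₁ := by rw [hs₁]; field_simp
          rw [e, div_le_iff₀ hC₁]
          linarith
        have hp : c₁ / C₁ * ρ r ≤ p r := by
          refine le_trans ?_ (h.le_p r hrb (hσy r hrb hXr hs))
          calc c₁ / C₁ * ρ r ≤ c₁ / C₁ * (C₁ * (δ * χ (r - a) * exp (w * y r))) := by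
                gcongr; exact h.ρ_le r hrb
            _ = _ := by field_simp
        have hfr2 : s₁ / (1 + s₁) ≤ σ r / (1 + σ r) := by
          rw [div_le_div_iff₀ (by positivity) (by positivity)]
          linarith
        have h4 : 8 * π * r * ρ r ≤ θ * (σ r / (1 + σ r)) * (4 * π * r * (w * p r)) := by
          calc 8 * π * r * ρ r
              = θ * (s₁ / (1 + s₁)) * (4 * π * r * (w * (c₁ / C₁ * ρ r))) := by
                rw [hθ]; field_simp; ring
            _ ≤ _ := by gcongr
        have h5 := mul_le_mul_of_nonneg_left hbr hfrac
        linarith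
    by_contra! hcon
    exact absurd hneg (not_lt.2 (mul_nonneg hDr.le hcon))

/-- A priori bound at the inner boundary: a bound for `y` at the outer end `b` forces a bound at the
inner end `a`, uniformly for small `δ`. -/
theorem exists_apriori_bound (ha : 0 < a) (hab : a < b) (hw : 0 < w) (hC₁ : 0 < C₁) (hc₁ : 0 < c₁)
    (hc₀ : 0 < c₀) (hχ : ContDiff ℝ (⊤ : ℕ∞) χ) (hχ0 : ∀ x ≤ 0, χ x = 0) (hχn : ∀ x, 0 ≤ χ x)
    {d : ℝ} (hd : 0 < d) (yb : ℝ) :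
    ∃ δ₁ a₁ : ℝ, 0 < δ₁ ∧ ∀ δ, 0 < δ → δ < δ₁ → ∀ D y ρ p : ℝ → ℝ,
      ShellSystem a b w C₁ c₁ c₀ y₁ δ χ D y ρ p → d ≤ D a → y b ≤ yb → y a ≤ a₁ := by
  obtain ⟨β, κ, C, c, δ₁, hc, hδ₁, hC0, hκβ, hβ1, hχX, hD⟩ :=
    exists_rpow_le_D (y₁ := y₁) ha hab hw hC₁ hc₁ hc₀ hχ hχ0 hχn
  set X : ℝ → ℝ := fun r => ∫ s in (0:ℝ)..(r - a), χ s with hX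
  have hXn : ∀ r ∈ Icc a b, 0 ≤ X r := fun r hr =>
    intervalIntegral.integral_nonneg (by linarith [hr.1]) (fun s _ => hχn s)
  have hXc : Continuous X :=
    (continuous_primitive (fun _ _ => hχ.continuous.intervalIntegrable _ _) 0).comp
      (continuous_id.sub continuous_const)
  obtain ⟨Xm, hXm⟩ := (isCompact_Icc (a := a) (b := b)).exists_bound_of_continuousOn
    hXc.continuousOn
  set e := 1 - β - κ * (w / 2 + 1) with he
  have he0 : 0 ≤ e := by linarith
  set P := C * c ^ (-(w / 2 + 1)) * (max Xm 0) ^ e with hP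
  have hP0 : 0 ≤ P := mul_nonneg (mul_nonneg hC0 (rpow_nonneg hc.le _)) (rpow_nonneg (le_max_right _ _) _)
  set Q := w * 8 * π * b * C₁ * P with hQ
  have hb : 0 < b := ha.trans hab
  have hQ0 : 0 ≤ Q := mul_nonneg (by positivity) hP0
  set δ₂ := exp (-(w * yb)) / (2 * (Q + 1) * (b - a)) with hδ₂
  have hba : 0 < b - a := by linarith
  have hδ₂p : 0 < δ₂ := by positivity
  refine ⟨min δ₁ δ₂, -(log (exp (-(w * yb)) / 2 * d ^ (w / 2))) / w, lt_min hδ₁ hδ₂p,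
    fun δ hδ hδlt D y ρ p h hDa hyb => ?_⟩
  have hpow : ∀ r ∈ Icc a b, χ (r - a) * D r ^ (-(w / 2 + 1)) ≤ P := by
    intro r hr
    have hDr := h.D_pos r hr
    rcases (hXn r hr).lt_or_eq with hXr | hXr
    · have h1 : D r ^ (-(w / 2 + 1)) ≤ (c * X r ^ κ) ^ (-(w / 2 + 1)) :=
        rpow_le_rpow_of_nonpos (by positivity) (hD δ hδ (hδlt.trans_le (min_le_left _ _)) D y ρ p h r hr hXr)
          (by linarith)
      have h2 : (c * X r ^ κ) ^ (-(w / 2 + 1)) = c ^ (-(w / 2 + 1)) * X r ^ (-(κ * (w / 2 + 1))) := by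
        rw [mul_rpow hc.le (by positivity), ← rpow_mul hXr.le, mul_neg]
      calc χ (r - a) * D r ^ (-(w / 2 + 1))
          ≤ (C * X r ^ (1 - β)) * (c ^ (-(w / 2 + 1)) * X r ^ (-(κ * (w / 2 + 1)))) := by
            rw [← h2]
            exact mul_le_mul (hχX r hr.2) h1 (by positivity) (by positivity)
        _ = C * c ^ (-(w / 2 + 1)) * (X r ^ (1 - β) * X r ^ (-(κ * (w / 2 + 1)))) := by ring
        _ = C * c ^ (-(w / 2 + 1)) * X r ^ e := by
            rw [← rpow_add hXr, he, sub_eq_add_neg (1 - β)]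
        _ ≤ P := by
            have : X r ≤ max Xm 0 := ((le_abs_self _).trans (hXm r hr)).trans (le_max_left _ _)
            rw [hP]; gcongr
    · have h1 : χ (r - a) = 0 := by
        refine le_antisymm ?_ (hχn _)
        have := hχX r hr.2
        change χ (r - a) ≤ C * X r ^ (1 - β) at this
        rwa [← hXr, zero_rpow (by linarith), mul_zero] at this
      rw [h1, zero_mul]; exact hP0
  set q : ℝ → ℝ := fun r => exp (-(w * y r)) * D r ^ (-(w / 2)) with hq
  have hqd : ∀ r ∈ Icc a b, HasDerivAt q
      (w * 4 * π * r * (ρ r + p r) * (exp (-(w * y r)) * D r ^ (-(w / 2) - 1))) r := by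
    intro r hr
    have hDr := h.D_pos r hr
    have hr0 : 0 < r := ha.trans_le hr.1
    have := (((h.hasDerivAt_y r hr).const_mul w).neg.exp).mul
      ((h.hasDerivAt_D r hr).rpow_const (p := -(w / 2)) (Or.inl hDr.ne'))
    refine this.congr_deriv ?_
    have e1 : D r ^ (-(w / 2)) = D r * D r ^ (-(w / 2) - 1) := by
      rw [rpow_sub_one hDr.ne']; field_simp
    simp only [Pi.neg_apply]
    rw [e1]
    field_simp
    ring
  have hqle : ∀ r ∈ Icc a b,
      w * 4 * π * r * (ρ r + p r) * (exp (-(w * y r)) * D r ^ (-(w / 2) - 1)) ≤ Q * δ := by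
    intro r hr
    have hDr := h.D_pos r hr
    have hr0 : 0 < r := ha.trans_le hr.1
    have h1 : ρ r + p r ≤ 2 * C₁ * (δ * χ (r - a) * exp (w * y r)) := by
      linarith [h.ρ_le r hr, h.p_le r hr]
    have h2 : 0 < D r ^ (-(w / 2) - 1) := by positivity
    calc _ ≤ w * 4 * π * b * (2 * C₁ * (δ * χ (r - a) * exp (w * y r))) *
          (exp (-(w * y r)) * D r ^ (-(w / 2) - 1)) := by
          have := h.ρ_nonneg r hr
          have := h.p_nonneg r hr
          have := hr.2
          gcongr
      _ = w * 8 * π * b * C₁ * δ * (exp (w * y r) * exp (-(w * y r))) *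
          (χ (r - a) * D r ^ (-(w / 2 + 1))) := by
          rw [neg_add', sub_eq_add_neg]; ring_nf
      _ = w * 8 * π * b * C₁ * δ * (χ (r - a) * D r ^ (-(w / 2 + 1))) := by
          rw [← exp_add, add_neg_cancel, exp_zero, mul_one]
      _ ≤ w * 8 * π * b * C₁ * δ * P := by gcongr; exact hpow r hr
      _ = Q * δ := by rw [hQ]; ring
  have hmv : q b - q a ≤ Q * δ * (b - a) := by
    refine (convex_Icc a b).image_sub_le_mul_sub_of_deriv_le
      (fun r hr => (hqd r hr).continuousAt.continuousWithinAt)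
      (fun r hr => (hqd r (interior_subset hr)).differentiableAt.differentiableWithinAt)
      (fun r hr => ?_) a (left_mem_Icc.2 hab.le) b (right_mem_Icc.2 hab.le) hab.le
    rw [(hqd r (interior_subset hr)).deriv]
    exact hqle r (interior_subset hr)
  have hqb : exp (-(w * yb)) ≤ q b := by
    have hb' := right_mem_Icc.2 hab.le
    have h1 : 1 ≤ D b ^ (-(w / 2)) :=
      one_le_rpow_of_pos_of_le_one_of_nonpos (h.D_pos b hb') (by linarith [h.D_le b hb']) (by linarith)
    calc exp (-(w * yb)) = exp (-(w * yb)) * 1 := by ring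
      _ ≤ q b := by simp only [hq]; gcongr
  have hsmall : Q * δ * (b - a) ≤ exp (-(w * yb)) / 2 := by
    have h1 : δ ≤ δ₂ := (hδlt.trans_le (min_le_right _ _)).le
    calc Q * δ * (b - a) ≤ (Q + 1) * δ₂ * (b - a) := by gcongr; linarith
      _ = exp (-(w * yb)) / 2 := by rw [hδ₂]; field_simp
  have hqa : exp (-(w * yb)) / 2 ≤ exp (-(w * y a)) * d ^ (-(w / 2)) := by
    have h1 : D a ^ (-(w / 2)) ≤ d ^ (-(w / 2)) :=
      rpow_le_rpow_of_nonpos hd hDa (by linarith)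
    have h2 : q a ≤ exp (-(w * y a)) * d ^ (-(w / 2)) := by simp only [hq]; gcongr
    linarith
  have hfin : exp (-(w * yb)) / 2 * d ^ (w / 2) ≤ exp (-(w * y a)) := by
    calc _ ≤ exp (-(w * y a)) * d ^ (-(w / 2)) * d ^ (w / 2) := by gcongr
      _ = exp (-(w * y a)) := by
        rw [mul_assoc, ← rpow_add hd, neg_add_cancel, rpow_zero, mul_one]
  have hlog := log_le_log (by positivity) hfin
  rw [log_exp] at hlog
  rw [le_div_iff₀ hw]
  linarith

end ShellSystem

theorem truncMoment_exp_eq_ite {g : ℝ → ℝ} {K s : ℝ} (hg : Measurable g)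
    (hgK : ∀ α ∈ Icc (0:ℝ) 1, |g α| ≤ K) (hs : 0 < s) (y : ℝ) {B : ℝ} (hB : 0 ≤ B) :
    truncMoment g s (exp (2 * y)) B =
      if exp (-y) * √B < 1 then
        ∫ α in (0:ℝ)..(1 - exp (-y) * √B), g α * (exp (2 * y) * (1 - α) ^ 2 - B) ^ s
      else 0 := by
  set x := exp (-y) * √B with hx
  have hx0 : 0 ≤ x := by positivity
  have hxB : exp (2 * y) * x ^ 2 = B := by
    rw [hx, mul_pow, sq_sqrt hB, ← exp_nat_mul, ← mul_assoc, ← exp_add]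
    simp
  have hle : ∀ {v w : ℝ}, 0 ≤ v → v ≤ w → exp (2 * y) * v ^ 2 ≤ exp (2 * y) * w ^ 2 :=
    fun hv hvw => by gcongr
  split_ifs with h
  · have hm : 1 - x ∈ Icc (0:ℝ) 1 := ⟨by linarith, by linarith⟩
    unfold truncMoment
    rw [← integral_add_adjacent_intervals
      (intervalIntegrable_truncMoment hg hgK hs _ B (left_mem_Icc.2 zero_le_one) hm)
      (intervalIntegrable_truncMoment hg hgK hs _ B hm (right_mem_Icc.2 zero_le_one))]
    have h2 : ∫ α in (1 - x)..1, g α * max (exp (2 * y) * (1 - α) ^ 2 - B) 0 ^ s = 0 := by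
      rw [integral_congr (g := fun _ => 0)]
      · simp
      · intro α hα
        rw [uIcc_of_le hm.2] at hα
        have := hle (v := 1 - α) (w := x) (by linarith [hα.2]) (by linarith [hα.1])
        simp only
        rw [max_eq_right (by linarith), zero_rpow hs.ne', mul_zero]
    rw [h2, add_zero]
    refine integral_congr fun α hα => ?_
    rw [uIcc_of_le hm.1] at hα
    have := hle (v := x) (w := 1 - α) hx0 (by linarith [hα.2])
    rw [max_eq_left (by linarith)]
  · refine truncMoment_eq_zero hs (exp_pos _).le ?_
    have := hle (v := 1) (w := x) zero_le_one (not_lt.1 h)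
    linarith

/-- Common form of the kernels of the density and the pressure. -/
def shellKernel (c l n s L : ℝ) (g : ℝ → ℝ) (r y : ℝ) : ℝ :=
  2 * π * c * r ^ (2 * l) * exp (n * y) * truncMoment g s (exp (2 * y)) (1 + L / r ^ 2)

/-- Derivative of `shellKernel` along a curve `(r, y (r))` with slope `z`. -/
def shellKernelDeriv (c l n s L : ℝ) (g : ℝ → ℝ) (r y z : ℝ) : ℝ :=
  2 * π * c * exp (n * y) *
    ((2 * l * r ^ (2 * l - 1) + r ^ (2 * l) * (n * z)) *
        truncMoment g s (exp (2 * y)) (1 + L / r ^ 2) +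
      r ^ (2 * l) * (s * (2 * z * exp (2 * y) *
          truncMoment (fun α => g α * (1 - α) ^ 2) (s - 1) (exp (2 * y)) (1 + L / r ^ 2) +
        2 * L / r ^ 3 * truncMoment g (s - 1) (exp (2 * y)) (1 + L / r ^ 2))))

section shellKernel

variable {c l n s L K : ℝ} {g Φ : ℝ → ℝ}

theorem abs_mul_one_sub_sq_le (hgK : ∀ α ∈ Icc (0:ℝ) 1, |g α| ≤ K) :
    ∀ α ∈ Icc (0:ℝ) 1, |g α * (1 - α) ^ 2| ≤ K := fun α hα => by
  rw [abs_mul, abs_of_nonneg (sq_nonneg (1 - α))]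
  have h1 : (1 - α) ^ 2 ≤ 1 := pow_le_one₀ (by linarith [hα.2]) (by linarith [hα.1])
  exact (mul_le_of_le_one_right (abs_nonneg _) h1).trans (hgK α hα)

theorem Gfun_eq_shellKernel (hl : -(1/2) < l) (hΦ : Measurable Φ)
    (hΦK : ∀ α ∈ Icc (0:ℝ) 1, |Φ α| ≤ K) (hL : 0 ≤ L) (r y : ℝ) :
    Gfun l L Φ r y =
      shellKernel (cConst l) l 3 (l + 1 / 2) L (fun α => Φ α * (1 - α) ^ 2) r y := by
  unfold Gfun shellKernel
  rw [truncMoment_exp_eq_ite (g := fun α => Φ α * (1 - α) ^ 2) (hΦ.mul (by fun_prop)) (abs_mul_one_sub_sq_le hΦK) (by linarith) y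
    (by positivity)]
  split_ifs
  · congr 1
    refine integral_congr fun α _ => ?_
    rw [sub_sub]
  · rw [mul_zero]

theorem Hfun_eq_shellKernel (hl : -(1/2) < l) (hΦ : Measurable Φ)
    (hΦK : ∀ α ∈ Icc (0:ℝ) 1, |Φ α| ≤ K) (hL : 0 ≤ L) (r y : ℝ) :
    Hfun l L Φ r y = shellKernel (dConst l) l 1 (l + 3 / 2) L Φ r y := by
  unfold Hfun shellKernel
  rw [truncMoment_exp_eq_ite hΦ hΦK (by linarith) y (by positivity), one_mul]
  split_ifs
  · congr 1
    refine integral_congr fun α _ => ?_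
    rw [sub_sub]
  · rw [mul_zero]

theorem exp_two_mul_le_one_add_div (hL : 0 ≤ L) {y : ℝ} (hy : y ≤ 0) (r : ℝ) :
    exp (2 * y) ≤ 1 + L / r ^ 2 := by
  have h1 : exp (2 * y) ≤ 1 := exp_le_one_iff.2 (by linarith)
  have h2 : 0 ≤ L / r ^ 2 := by positivity
  linarith

theorem shellKernel_eq_zero (hs : 0 < s) (hL : 0 ≤ L) {y : ℝ} (hy : y ≤ 0) (r : ℝ) :
    shellKernel c l n s L g r y = 0 := by
  rw [shellKernel, truncMoment_eq_zero hs (exp_pos _).le (exp_two_mul_le_one_add_div hL hy r),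
    mul_zero]

theorem shellKernelDeriv_eq_zero (hs : 1 < s) (hL : 0 ≤ L) {y : ℝ} (hy : y ≤ 0) (r z : ℝ) :
    shellKernelDeriv c l n s L g r y z = 0 := by
  have h := exp_two_mul_le_one_add_div hL hy r
  rw [shellKernelDeriv, truncMoment_eq_zero (by linarith) (exp_pos _).le h,
    truncMoment_eq_zero (by linarith) (exp_pos _).le h,
    truncMoment_eq_zero (by linarith) (exp_pos _).le h]
  simp

theorem shellKernel_nonneg (hc : 0 ≤ c) (hg0 : ∀ α, 0 ≤ g α) {r : ℝ} (hr : 0 ≤ r) (y : ℝ) :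
    0 ≤ shellKernel c l n s L g r y := by
  have := truncMoment_nonneg (s := s) hg0 (exp (2 * y)) (1 + L / r ^ 2)
  unfold shellKernel
  positivity

theorem exists_shellKernel_le (hc : 0 ≤ c) (hgK : ∀ α ∈ Icc (0:ℝ) 1, |g α| ≤ K) (hs : 0 < s)
    (hL : 0 ≤ L) {a b : ℝ} (ha : 0 < a) :
    ∃ C, 0 < C ∧ ∀ r ∈ Icc a b, ∀ y,
      shellKernel c l n s L g r y ≤ C * exp ((n + 2 * s) * y) := by
  have hcont : ContinuousOn (fun r : ℝ => r ^ (2 * l)) (Icc a b) := fun r hr =>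
    (continuousAt_rpow_const r _ (Or.inl (ha.trans_le hr.1).ne')).continuousWithinAt
  obtain ⟨R, hR⟩ := (isCompact_Icc (a := a) (b := b)).exists_bound_of_continuousOn hcont
  have hK : 0 ≤ K := (abs_nonneg _).trans (hgK 0 (by simp))
  refine ⟨2 * π * c * (max R 0) * K + 1, by positivity, fun r hr y => ?_⟩
  have hr0 : 0 < r := ha.trans_le hr.1
  have h1 : r ^ (2 * l) ≤ max R 0 := ((le_abs_self _).trans (hR r hr)).trans (le_max_left _ _)
  have h2 := truncMoment_le hgK hs (exp_pos (2 * y)).le (by positivity : 0 ≤ 1 + L / r ^ 2)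
  have h3 : exp (n * y) * exp (2 * y) ^ s = exp ((n + 2 * s) * y) := by
    rw [← exp_mul, ← exp_add]; ring_nf
  calc shellKernel c l n s L g r y
      ≤ 2 * π * c * r ^ (2 * l) * exp (n * y) * (K * exp (2 * y) ^ s) := by
        unfold shellKernel; gcongr
    _ ≤ 2 * π * c * max R 0 * exp (n * y) * (K * exp (2 * y) ^ s) := by gcongr
    _ = 2 * π * c * max R 0 * K * exp ((n + 2 * s) * y) := by rw [← h3]; ring
    _ ≤ _ := by gcongr; linarith

theorem exists_le_shellKernel (hc : 0 < c) (hg : Measurable g)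
    (hgK : ∀ α ∈ Icc (0:ℝ) 1, |g α| ≤ K) (hg0 : ∀ α, 0 ≤ g α) {α₀ : ℝ} (hα₀ : 0 < α₀)
    (hgpos : ∀ α ∈ Ioo 0 α₀, 0 < g α) (hs : 0 < s) (hL : 0 ≤ L) {a b : ℝ} (ha : 0 < a) :
    ∃ c', 0 < c' ∧ ∀ r ∈ Icc a b, ∀ y, log (8 * (1 + L / a ^ 2)) / 2 ≤ y →
      c' * exp ((n + 2 * s) * y) ≤ shellKernel c l n s L g r y := by
  have hcont : ContinuousOn (fun r : ℝ => r ^ (2 * l)) (Icc a b) := fun r hr =>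
    (continuousAt_rpow_const r _ (Or.inl (ha.trans_le hr.1).ne')).continuousWithinAt
  obtain ⟨m, hm0, hm⟩ := (isCompact_Icc (a := a) (b := b)).exists_forall_le' hcont
    (a := 0) (fun r hr => rpow_pos_of_pos (ha.trans_le hr.1) _)
  obtain ⟨c₁, hc₁, hT⟩ := exists_le_truncMoment hg hgK hg0 hα₀ hgpos hs
  refine ⟨2 * π * c * m * c₁, by positivity, fun r hr y hy => ?_⟩
  have hr0 : 0 < r := ha.trans_le hr.1
  have h3 : exp (n * y) * exp (2 * y) ^ s = exp ((n + 2 * s) * y) := by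
    rw [← exp_mul, ← exp_add]; ring_nf
  have h4 : 8 * (1 + L / r ^ 2) ≤ exp (2 * y) := by
    have h5 : 8 * (1 + L / r ^ 2) ≤ 8 * (1 + L / a ^ 2) := by
      have := hr.1
      gcongr
    refine h5.trans ?_
    rw [← log_le_iff_le_exp (by positivity)]
    linarith
  have h2 := hT (exp (2 * y)) _ (exp_pos _).le h4
  have hmr := hm r hr
  calc 2 * π * c * m * c₁ * exp ((n + 2 * s) * y)
      = 2 * π * c * m * exp (n * y) * (c₁ * exp (2 * y) ^ s) := by rw [← h3]; ring
    _ ≤ 2 * π * c * r ^ (2 * l) * exp (n * y) * (c₁ * exp (2 * y) ^ s) := by gcongr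
    _ ≤ shellKernel c l n s L g r y := by unfold shellKernel; gcongr

theorem continuousOn_truncMoment_exp (hg : Measurable g)
    (hgK : ∀ α ∈ Icc (0:ℝ) 1, |g α| ≤ K) (hs : 0 < s) :
    ContinuousOn (fun q : ℝ × ℝ => truncMoment g s (exp (2 * q.2)) (1 + L / q.1 ^ 2))
      (Ioi 0 ×ˢ univ) := by
  refine (continuous_truncMoment hg hgK hs).comp_continuousOn
    (f := fun q : ℝ × ℝ => (exp (2 * q.2), 1 + L / q.1 ^ 2)) ?_
  refine ContinuousOn.prodMk (by fun_prop) (continuousOn_const.add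
    (continuousOn_const.div (by fun_prop) fun q hq => ?_))
  have : 0 < q.1 := hq.1
  positivity

theorem continuousOn_shellKernel (hg : Measurable g)
    (hgK : ∀ α ∈ Icc (0:ℝ) 1, |g α| ≤ K) (hs : 0 < s) :
    ContinuousOn (fun q : ℝ × ℝ => shellKernel c l n s L g q.1 q.2) (Ioi 0 ×ˢ univ) := by
  have h1 : ContinuousOn (fun q : ℝ × ℝ => q.1 ^ (2 * l)) (Ioi 0 ×ˢ univ) :=
    continuousOn_fst.rpow_const fun q hq => Or.inl (ne_of_gt hq.1)
  unfold shellKernel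
  exact ((continuousOn_const.mul h1).mul (by fun_prop)).mul (continuousOn_truncMoment_exp hg hgK hs)

theorem continuousOn_shellKernelDeriv (hg : Measurable g)
    (hgK : ∀ α ∈ Icc (0:ℝ) 1, |g α| ≤ K) (hs : 1 < s) :
    ContinuousOn (fun q : ℝ × ℝ × ℝ => shellKernelDeriv c l n s L g q.1 q.2.1 q.2.2)
      (Ioi 0 ×ˢ univ) := by
  have h1 : ∀ t : ℝ, ContinuousOn (fun q : ℝ × ℝ × ℝ => q.1 ^ t) (Ioi 0 ×ˢ univ) := fun t =>
    continuousOn_fst.rpow_const fun q hq => Or.inl (ne_of_gt hq.1)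
  have hmap : MapsTo (fun q : ℝ × ℝ × ℝ => (q.1, q.2.1)) (Ioi 0 ×ˢ univ) (Ioi 0 ×ˢ univ) :=
    fun q hq => ⟨hq.1, trivial⟩
  have hf : ContinuousOn (fun q : ℝ × ℝ × ℝ => (q.1, q.2.1)) (Ioi 0 ×ˢ univ) := by fun_prop
  have hg' : Measurable fun α => g α * (1 - α) ^ 2 := hg.mul (by fun_prop)
  have hT := (continuousOn_truncMoment_exp (L := L) hg hgK (by linarith : 0 < s)).comp hf hmap
  have hT1 := (continuousOn_truncMoment_exp (L := L) hg hgK (by linarith : 0 < s - 1)).comp hf hmap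
  have hT2 := (continuousOn_truncMoment_exp (L := L) hg' (abs_mul_one_sub_sq_le hgK)
    (by linarith : 0 < s - 1)).comp hf hmap
  have hL3 : ContinuousOn (fun q : ℝ × ℝ × ℝ => 2 * L / q.1 ^ 3) (Ioi 0 ×ˢ univ) :=
    continuousOn_const.div (by fun_prop) fun q hq => by
      have : 0 < q.1 := hq.1
      positivity
  unfold shellKernelDeriv
  refine ContinuousOn.mul (by fun_prop) (ContinuousOn.add (ContinuousOn.mul ?_ hT)
    ((h1 _).mul (continuousOn_const.mul (ContinuousOn.add (ContinuousOn.mul (by fun_prop) hT2)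
      (hL3.mul hT1)))))
  exact (continuousOn_const.mul (h1 _)).add ((h1 _).mul (by fun_prop))

theorem exists_abs_shellKernelDeriv_le (hg : Measurable g)
    (hgK : ∀ α ∈ Icc (0:ℝ) 1, |g α| ≤ K) (hs : 1 < s) (hL : 0 ≤ L) {a : ℝ} (ha : 0 < a)
    (b ymax zmax : ℝ) :
    ∃ C, ∀ r ∈ Icc a b, ∀ y ≤ ymax, ∀ z, |z| ≤ zmax →
      |shellKernelDeriv c l n s L g r y z| ≤ C := by
  have hK : IsCompact (Icc a b ×ˢ (Icc 0 ymax ×ˢ Icc (-zmax) zmax)) :=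
    isCompact_Icc.prod (isCompact_Icc.prod isCompact_Icc)
  obtain ⟨C, hC⟩ := hK.exists_bound_of_continuousOn
    ((continuousOn_shellKernelDeriv (c := c) (l := l) (n := n) (L := L) hg hgK hs).mono
      fun q hq => ⟨ha.trans_le hq.1.1, trivial⟩)
  refine ⟨max C 0, fun r hr y hy z hz => ?_⟩
  rcases le_or_gt y 0 with h | h
  · rw [shellKernelDeriv_eq_zero hs hL h, abs_zero]
    exact le_max_right _ _
  · exact (hC (r, y, z) ⟨hr, ⟨h.le, hy⟩, abs_le.1 hz⟩).trans (le_max_left _ _)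

theorem hasDerivAt_shellKernel (hg : Measurable g)
    (hgK : ∀ α ∈ Icc (0:ℝ) 1, |g α| ≤ K) (hs : 1 < s) {a : ℝ} (ha : 0 ≤ a) {y y' : ℝ → ℝ}
    (hy : ∀ r ∈ Ioi a, HasDerivAt y (y' r) r) (hy' : ContinuousOn y' (Ioi a)) {r : ℝ}
    (hr : r ∈ Ioi a) :
    HasDerivAt (fun r => shellKernel c l n s L g r (y r))
      (shellKernelDeriv c l n s L g r (y r) (y' r)) r := by
  have hr0 : 0 < r := ha.trans_lt hr
  have hnhds : Ioi a ∈ 𝓝 r := Ioi_mem_nhds hr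
  have hyc : ContinuousAt y r := (hy r hr).continuousAt
  have hyc' : ContinuousAt y' r := hy'.continuousAt hnhds
  have hu : ∀ t ∈ Ioi a, HasDerivAt (fun t => exp (2 * y t)) (exp (2 * y t) * (2 * y' t)) t :=
    fun t ht => ((hy t ht).const_mul 2).exp
  have hB : ∀ t ∈ Ioi a, HasDerivAt (fun t => 1 + L / t ^ 2) (-(2 * L) / t ^ 3) t := fun t ht => by
    have ht0 : t ≠ 0 := (ha.trans_lt ht).ne'
    have := (((hasDerivAt_pow 2 t).inv (pow_ne_zero 2 ht0)).const_mul L).const_add 1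
    refine this.congr_deriv ?_
    field_simp
    push_cast
    ring
  have hT := hasDerivAt_truncMoment hg hgK hs (r₀ := r) (eventually_of_mem hnhds hu)
    (eventually_of_mem hnhds hB) (by fun_prop)
    (continuousAt_const.div (by fun_prop) (by positivity))
  have h1 : HasDerivAt (fun t : ℝ => t ^ (2 * l)) (2 * l * r ^ (2 * l - 1)) r :=
    hasDerivAt_rpow_const (Or.inl hr0.ne')
  have h2 : HasDerivAt (fun t => exp (n * y t)) (exp (n * y r) * (n * y' r)) r :=
    ((hy r hr).const_mul n).exp
  have := ((h1.const_mul (2 * π * c)).mul h2).mul hT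
  refine this.congr_deriv ?_
  simp only [shellKernelDeriv, Pi.mul_apply]
  ring

end shellKernel

theorem continuous_of_continuousOn_Ioi_of_eq_zero {f : ℝ → ℝ} {a b : ℝ} (hab : a < b)
    (h0 : ∀ x ≤ b, f x = 0) (hf : ContinuousOn f (Ioi a)) : Continuous f := by
  rw [continuous_iff_continuousAt]
  intro x
  rcases lt_or_ge x b with hx | hx
  · exact continuousAt_const.congr
      (eventually_of_mem (Iio_mem_nhds hx) fun z hz => (h0 z (le_of_lt hz)).symm)
  · exact hf.continuousAt (Ioi_mem_nhds (hab.trans_le hx))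

/-- A solution of the reduced field equations outside a black hole of mass `M`, with matter
supported in `r > a`. -/
structure ShellSolution (M a : ℝ) (y m ρ p p' : ℝ → ℝ) : Prop where
  hasDerivAt_y : ∀ r ∈ Ioi (2 * M), HasDerivAt y
    (-(1 - 2 / r * (M + m r))⁻¹ * ((M + m r) / r ^ 2 + 4 * π * r * p r)) r
  hasDerivAt_m : ∀ r ∈ Ioi (2 * M), HasDerivAt m (4 * π * (r ^ 2 * ρ r)) r
  hasDerivAt_p : ∀ r ∈ Ioi (2 * M), HasDerivAt p (p' r) r
  continuousOn_ρ : ContinuousOn ρ (Ioi (2 * M))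
  continuousOn_p' : ContinuousOn p' (Ioi (2 * M))
  D_pos : ∀ r ∈ Ioi (2 * M), 0 < 1 - 2 / r * (M + m r)
  ρ_nonneg : ∀ r ∈ Ioi (2 * M), 0 ≤ ρ r
  p_nonneg : ∀ r ∈ Ioi (2 * M), 0 ≤ p r
  m_nonneg : ∀ r ∈ Ioi (2 * M), 0 ≤ m r
  m_eq_zero : ∀ r ≤ a, m r = 0

/-- The derivative of the pressure along a solution. -/
def pDeriv (l L δ a : ℝ) (Φ χ y : ℝ → ℝ) (r : ℝ) : ℝ :=
  δ * (deriv χ (r - a) * Hfun l L Φ r (y r) +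
    χ (r - a) * shellKernelDeriv (dConst l) l 1 (l + 3 / 2) L Φ r (y r) (deriv y r))

theorem lapse_pos_of_continuousOn_deriv {M a : ℝ} (ha : 2 * M < a)
    {y D N : ℝ → ℝ} (hy : ContinuousOn (deriv y) (Ioi (2 * M)))
    (hDc : ContinuousOn D (Ioi (2 * M))) (hNc : ContinuousOn N (Ioi (2 * M)))
    (hyd : ∀ r ∈ Ioi (2 * M), HasDerivAt y (-(D r)⁻¹ * N r) r)
    (hN : ∀ r ∈ Ioi (2 * M), 0 < N r) (hDa : ∀ r ∈ Ioc (2 * M) a, 0 < D r) :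
    ∀ r ∈ Ioi (2 * M), 0 < D r := by
  intro r hr
  by_contra! hcon
  have har : a < r := by
    by_contra! h
    exact absurd (hDa r ⟨hr, h⟩) (not_lt.2 hcon)
  have hsub : Icc a r ⊆ Ioi (2 * M) := fun s hs => ha.trans_le hs.1
  have hcl : IsClosed {s ∈ Icc a r | D s ≤ 0} :=
    isClosed_Icc.isClosed_le (hDc.mono hsub) continuousOn_const
  have hcomp : IsCompact {s ∈ Icc a r | D s ≤ 0} :=
    isCompact_Icc.of_isClosed_subset hcl fun s hs => hs.1
  obtain ⟨r₁, hr₁, hleast⟩ := hcomp.exists_isLeast ⟨r, ⟨har.le, le_rfl⟩, hcon⟩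
  have har₁ : a < r₁ := by
    rcases hr₁.1.1.lt_or_eq with h | h
    · exact h
    · exact absurd (hDa r₁ ⟨h ▸ ha, h.ge⟩) (not_lt.2 hr₁.2)
  have hpos : ∀ s ∈ Ioo a r₁, 0 < D s := fun s hs => by
    by_contra! h
    exact absurd (hleast ⟨⟨hs.1.le, hs.2.le.trans hr₁.1.2⟩, h⟩) (not_le.2 hs.2)
  have hr₁M : r₁ ∈ Ioi (2 * M) := ha.trans har₁
  have hIoo : Ioo a r₁ ∈ 𝓝[<] r₁ := Ioo_mem_nhdsLT har₁
  have hDt : Tendsto D (𝓝[<] r₁) (𝓝 (D r₁)) :=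
    (hDc.continuousAt (Ioi_mem_nhds hr₁M)).tendsto.mono_left nhdsWithin_le_nhds
  have hNt : Tendsto N (𝓝[<] r₁) (𝓝 (N r₁)) :=
    (hNc.continuousAt (Ioi_mem_nhds hr₁M)).tendsto.mono_left nhdsWithin_le_nhds
  have hyt : Tendsto (deriv y) (𝓝[<] r₁) (𝓝 (deriv y r₁)) :=
    (hy.continuousAt (Ioi_mem_nhds hr₁M)).tendsto.mono_left nhdsWithin_le_nhds
  have hD0 : D r₁ = 0 := le_antisymm hr₁.2
    (ge_of_tendsto hDt (eventually_of_mem hIoo fun s hs => (hpos s hs).le))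
  have hsum := (hyt.mul hDt).add hNt
  have hzero : ∀ᶠ s in 𝓝[<] r₁, deriv y s * D s + N s = 0 :=
    eventually_of_mem hIoo fun s hs => by
      have := (hpos s hs).ne'
      rw [(hyd s (ha.trans hs.1)).deriv]
      field_simp
      ring
  have := tendsto_nhds_unique (hsum.congr' hzero) tendsto_const_nhds
  rw [hD0, mul_zero, zero_add] at this
  exact (hN r₁ hr₁M).ne' this

section

variable {M l L K δ a y₀ : ℝ} {Φ χ y : ℝ → ℝ}

theorem ShellSolution.of_isShellSolution (hM : 0 < M) (hl : -(1/2) < l) (hΦ : Measurable Φ)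
    (hΦK : ∀ α ∈ Icc (0:ℝ) 1, |Φ α| ≤ K) (hΦ0 : ∀ x, 0 ≤ Φ x) (hL : 0 ≤ L) (ha : 2 * M < a)
    (hχ : ContDiff ℝ (⊤ : ℕ∞) χ) (hχn : ∀ x, 0 ≤ χ x) (hχ0 : ∀ x ≤ 0, χ x = 0) (hδ : 0 ≤ δ)
    (h : IsShellSolution M l L δ a y₀ Φ χ y) :
    ShellSolution M a y (mFun M l L δ a Φ χ y) (rhoFun l L δ a Φ χ y) (pFun l L δ a Φ χ y)
      (pDeriv l L δ a Φ χ y) := by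
  obtain ⟨hyc', -, hyd⟩ := h
  have hΦ' : Measurable fun α => Φ α * (1 - α) ^ 2 := hΦ.mul (by fun_prop)
  have hs₁ : 0 < l + 1 / 2 := by linarith
  have hs₂ : 1 < l + 3 / 2 := by linarith
  have hr0 : ∀ {r}, r ∈ Ioi (2 * M) → 0 < r := fun hr =>
    lt_trans (by positivity) (mem_Ioi.1 hr)
  have hyc : ContinuousOn y (Ioi (2 * M)) := fun r hr =>
    (hyd r hr).continuousAt.continuousWithinAt
  have hmaps : MapsTo (fun r => (r, y r)) (Ioi (2 * M)) (Ioi 0 ×ˢ univ) :=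
    fun r hr => ⟨hr0 hr, trivial⟩
  have hχc : Continuous fun r => χ (r - a) := hχ.continuous.comp (by fun_prop)
  have hρc : ContinuousOn (rhoFun l L δ a Φ χ y) (Ioi (2 * M)) := by
    unfold rhoFun
    simp only [Gfun_eq_shellKernel hl hΦ hΦK hL]
    exact (continuousOn_const.mul hχc.continuousOn).mul ((continuousOn_shellKernel hΦ'
      (abs_mul_one_sub_sq_le hΦK) hs₁).comp (continuousOn_id.prodMk hyc) hmaps)
  have hρn : ∀ r ∈ Ioi (2 * M), 0 ≤ rhoFun l L δ a Φ χ y r := fun r hr => by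
    rw [rhoFun, Gfun_eq_shellKernel hl hΦ hΦK hL]
    exact mul_nonneg (mul_nonneg hδ (hχn _)) (shellKernel_nonneg (cConst_pos hl).le
      (fun α => mul_nonneg (hΦ0 α) (sq_nonneg _)) (hr0 hr).le _)
  have hpn : ∀ r ∈ Ioi (2 * M), 0 ≤ pFun l L δ a Φ χ y r := fun r hr => by
    rw [pFun, Hfun_eq_shellKernel hl hΦ hΦK hL]
    exact mul_nonneg (mul_nonneg hδ (hχn _)) (shellKernel_nonneg (dConst_pos hl).le
      hΦ0 (hr0 hr).le _)
  have hρ0 : ∀ r ≤ a, rhoFun l L δ a Φ χ y r = 0 := fun r hr => by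
    rw [rhoFun, hχ0 _ (by linarith), mul_zero, zero_mul]
  have hfc : Continuous fun s => s ^ 2 * rhoFun l L δ a Φ χ y s :=
    continuous_of_continuousOn_Ioi_of_eq_zero ha (fun s hs => by simp only [hρ0 s hs, mul_zero])
      (ContinuousOn.mul (by fun_prop) hρc)
  have hm : ∀ r, HasDerivAt (mFun M l L δ a Φ χ y)
      (4 * π * (r ^ 2 * rhoFun l L δ a Φ χ y r)) r := fun r =>
    (hfc.integral_hasStrictDerivAt (2 * M) r).hasDerivAt.const_mul _
  have hm0 : ∀ r ≤ a, mFun M l L δ a Φ χ y r = 0 := fun r hr => by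
    rw [mFun, integral_congr (g := fun _ => 0)]
    · simp
    · intro s hs
      have : s ≤ a := hs.2.trans (max_le ha.le hr)
      simp only [hρ0 s this, mul_zero]
  have hmn : ∀ r ∈ Ioi (2 * M), 0 ≤ mFun M l L δ a Φ χ y r := fun r hr => by
    refine mul_nonneg (by positivity) (integral_nonneg_of_ae_restrict (le_of_lt hr) ?_)
    refine (ae_restrict_iff' measurableSet_Icc).2 (Eventually.of_forall fun s hs => ?_)
    rcases hs.1.lt_or_eq with h | h
    · exact mul_nonneg (sq_nonneg _) (hρn s h)
    · simp only [hρ0 s (h ▸ ha.le), mul_zero, Pi.zero_apply, le_refl]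
  have hp : ∀ r ∈ Ioi (2 * M), HasDerivAt (pFun l L δ a Φ χ y) (pDeriv l L δ a Φ χ y r) r := by
    intro r hr
    have h1 := hasDerivAt_shellKernel (c := dConst l) (l := l) (n := 1) (L := L) hΦ hΦK hs₂
      (by positivity) (fun r hr => (hyd r hr).differentiableAt.hasDerivAt) hyc' hr
    have h2 : HasDerivAt (fun r => χ (r - a)) (deriv χ (r - a)) r :=
      ((hχ.differentiable (by simp)).differentiableAt.hasDerivAt (x := r - a)).comp_sub_const r a
    unfold pFun pDeriv
    simp only [Hfun_eq_shellKernel hl hΦ hΦK hL]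
    refine ((h2.const_mul δ).mul h1).congr_deriv ?_
    ring
  have hp' : ContinuousOn (pDeriv l L δ a Φ χ y) (Ioi (2 * M)) := by
    have h3 : Continuous fun r => deriv χ (r - a) :=
      (hχ.continuous_deriv (by simp)).comp (by fun_prop)
    unfold pDeriv
    simp only [Hfun_eq_shellKernel hl hΦ hΦK hL]
    refine continuousOn_const.mul ((h3.continuousOn.mul ((continuousOn_shellKernel hΦ
      hΦK (by linarith)).comp (continuousOn_id.prodMk hyc) hmaps)).add (hχc.continuousOn.mul ?_))
    exact (continuousOn_shellKernelDeriv hΦ hΦK hs₂).comp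
      (continuousOn_id.prodMk (hyc.prodMk hyc')) fun r hr => ⟨hr0 hr, trivial⟩
  have hmc : Continuous (mFun M l L δ a Φ χ y) :=
    continuous_iff_continuousAt.2 fun r => (hm r).continuousAt
  have hpc : ContinuousOn (pFun l L δ a Φ χ y) (Ioi (2 * M)) := fun r hr =>
    (hp r hr).continuousAt.continuousWithinAt
  have hD := lapse_pos_of_continuousOn_deriv ha hyc'
    (D := fun r => 1 - 2 / r * (M + mFun M l L δ a Φ χ y r))
    (N := fun r => (M + mFun M l L δ a Φ χ y r) / r ^ 2 + 4 * π * r * pFun l L δ a Φ χ y r)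
    (continuousOn_const.sub ((continuousOn_const.div continuousOn_id fun r hr => (hr0 hr).ne').mul
      (by fun_prop)))
    ((ContinuousOn.div (by fun_prop) (by fun_prop)
      fun r hr => pow_ne_zero 2 (hr0 hr).ne').add (ContinuousOn.mul (by fun_prop) hpc))
    hyd (fun r hr => by
      have := hr0 hr
      have := hmn r hr
      have := hpn r hr
      positivity)
    (fun r hr => by
      have h1 : 2 * M < r := hr.1
      simp only [hm0 r hr.2, add_zero]
      have : 2 / r * M < 1 := by
        rw [div_mul_eq_mul_div, div_lt_one (hr0 hr.1)]
        exact h1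
      linarith)
  exact ⟨hyd, fun r _ => hm r, hp, hρc, hp', hD, hρn, hpn, hmn, hm0⟩

end

theorem hasDerivAt_half_log_lapse {M r : ℝ} (hM : 0 < M) (hr : r ∈ Ioi (2 * M)) :
    HasDerivAt (fun r => 1 / 2 * log (1 - 2 * M / r)) (M / r ^ 2 / (1 - 2 * M / r)) r := by
  have hr' : 2 * M < r := hr
  have hr0 : 0 < r := lt_trans (by positivity) hr'
  have hD : 0 < 1 - 2 * M / r := by rw [sub_pos, div_lt_one hr0]; exact hr'
  have h1 : HasDerivAt (fun r => 1 - 2 * M / r) (2 * M / r ^ 2) r := by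
    refine (((hasDerivAt_inv hr0.ne').const_mul (2 * M)).const_sub 1).congr_deriv ?_
    field_simp
  refine ((h1.log hD.ne').const_mul (1 / 2)).congr_deriv ?_
  field_simp

namespace ShellSolution

variable {M a : ℝ} {y m ρ p p' : ℝ → ℝ}

theorem hasDerivAt_D (h : ShellSolution M a y m ρ p p') (hM : 0 < M) {r : ℝ}
    (hr : r ∈ Ioi (2 * M)) :
    HasDerivAt (fun r => 1 - 2 / r * (M + m r))
      (2 * (M + m r) / r ^ 2 - 8 * π * r * ρ r) r := by
  have hr0 : 0 < r := lt_trans (by positivity) (mem_Ioi.1 hr)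
  refine ((((hasDerivAt_inv hr0.ne').const_mul 2).mul
    ((h.hasDerivAt_m r hr).const_add M)).const_sub 1).congr_deriv ?_
  field_simp
  ring

theorem antitoneOn_y (h : ShellSolution M a y m ρ p p') (hM : 0 < M) :
    AntitoneOn y (Ioi (2 * M)) := by
  refine antitoneOn_of_deriv_nonpos (convex_Ioi _)
    (fun r hr => (h.hasDerivAt_y r hr).continuousAt.continuousWithinAt)
    (fun r hr => (h.hasDerivAt_y r (interior_subset hr)).differentiableAt.differentiableWithinAt)
    (fun r hr => ?_)
  have hr' := interior_subset hr
  have hr0 : 0 < r := lt_trans (by positivity) (mem_Ioi.1 hr')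
  have := h.D_pos r hr'
  have := h.m_nonneg r hr'
  have := h.p_nonneg r hr'
  rw [(h.hasDerivAt_y r hr').deriv, neg_mul]
  exact neg_nonpos.2 (by positivity)

theorem antitoneOn_add_log (h : ShellSolution M a y m ρ p p') (hM : 0 < M) :
    AntitoneOn (fun r => y r + 1 / 2 * log (1 - 2 * M / r)) (Ioi (2 * M)) := by
  have hd : ∀ r ∈ Ioi (2 * M), HasDerivAt (fun r => y r + 1 / 2 * log (1 - 2 * M / r)) _ r :=
    fun r hr => (h.hasDerivAt_y r hr).add (hasDerivAt_half_log_lapse hM hr)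
  refine antitoneOn_of_deriv_nonpos (convex_Ioi _)
    (fun r hr => (hd r hr).continuousAt.continuousWithinAt)
    (fun r hr => (hd r (interior_subset hr)).differentiableAt.differentiableWithinAt)
    (fun r hr => ?_)
  have hr' := interior_subset hr
  have hr0 : 0 < r := lt_trans (by positivity) (mem_Ioi.1 hr')
  have hD := h.D_pos r hr'
  have hm := h.m_nonneg r hr'
  have hp := h.p_nonneg r hr'
  rw [(hd r hr').deriv]
  have h1 : 1 - 2 / r * (M + m r) ≤ 1 - 2 * M / r := by
    have : 0 ≤ 2 / r * m r := by positivity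
    have e : 2 / r * (M + m r) = 2 * M / r + 2 / r * m r := by ring
    linarith
  have h2 : M / r ^ 2 ≤ (M + m r) / r ^ 2 + 4 * π * r * p r := by
    have : 0 ≤ m r / r ^ 2 + 4 * π * r * p r := by positivity
    rw [add_div]; linarith
  have h3 : M / r ^ 2 / (1 - 2 * M / r) ≤
      ((M + m r) / r ^ 2 + 4 * π * r * p r) / (1 - 2 / r * (M + m r)) :=
    div_le_div₀ ((by positivity : 0 ≤ M / r ^ 2).trans h2) h2 hD h1
  rw [neg_mul, inv_mul_eq_div]
  linarith

theorem y_le (h : ShellSolution M a y m ρ p p') (hM : 0 < M) {E : ℝ} (hE : 0 < E)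
    (hy : y (4 * M) = log (√2 * E)) {r : ℝ} (hr : 4 * M ≤ r) :
    y r ≤ log E - 1 / 2 * log (1 - 2 * M / r) := by
  have h4 : 4 * M ∈ Ioi (2 * M) := mem_Ioi.2 (by linarith)
  have := h.antitoneOn_add_log hM h4 (mem_Ioi.2 (lt_of_lt_of_le h4 hr)) hr
  have e : 1 - 2 * M / (4 * M) = 2⁻¹ := by field_simp; norm_num
  simp only [hy, e, log_inv] at this
  rw [log_mul (by positivity) hE.ne', log_sqrt (by norm_num)] at this
  linarith

theorem y_nonpos (h : ShellSolution M a y m ρ p p') (hM : 0 < M) {E : ℝ} (hE : 0 < E)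
    (hE1 : E < 1) (hy : y (4 * M) = log (√2 * E)) {r : ℝ} (hr : 4 * M ≤ r)
    (hrE : 2 * M / (1 - E ^ 2) ≤ r) : y r ≤ 0 := by
  have hE2 : 0 < 1 - E ^ 2 := by nlinarith
  have hr0 : 0 < r := lt_of_lt_of_le (by positivity) hr
  have h1 : E ^ 2 ≤ 1 - 2 * M / r := by
    have : 2 * M / r ≤ 1 - E ^ 2 := by
      rw [div_le_iff₀ hE2] at hrE
      rw [div_le_iff₀ hr0]
      linarith
    linarith
  have h2 := log_le_log (by positivity) h1
  rw [log_pow] at h2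
  have := h.y_le hM hE hy hr
  push_cast at h2
  linarith

end ShellSolution

/-- Quantitative smallness of the matter quantities, supported in `[a, R]`. -/
structure ShellBounds (M a R K D₁ δ : ℝ) (m ρ p p' : ℝ → ℝ) : Prop where
  ρ_le : ∀ r ∈ Ioi (2 * M), ρ r ≤ K * δ
  p_le : ∀ r ∈ Ioi (2 * M), p r ≤ K * δ
  m_le : ∀ r ∈ Ioi (2 * M), m r ≤ K * δ
  abs_p'_le : ∀ r ∈ Ioi (2 * M), |p' r| ≤ K * δ
  eq_zero : ∀ r ∈ Ioi (2 * M), r ≤ a ∨ R ≤ r → ρ r = 0 ∧ p r = 0 ∧ p' r = 0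
  le_D : ∀ r, a ≤ r → D₁ ≤ 1 - 2 / r * (M + m r)

section

variable {M l L K a α₀ E : ℝ} {Φ χ : ℝ → ℝ}

theorem exists_y_le (hM : 0 < M) (hl : -(1/2) < l) (hΦ : Measurable Φ)
    (hΦK : ∀ α ∈ Icc (0:ℝ) 1, |Φ α| ≤ K) (hΦ0 : ∀ x, 0 ≤ Φ x) (hα₀ : 0 < α₀)
    (hΦpos : ∀ x ∈ Ioo 0 α₀, 0 < Φ x) (hL : 0 ≤ L) (ha : 2 * M < a)
    (hχ : ContDiff ℝ (⊤ : ℕ∞) χ) (hχn : ∀ x, 0 ≤ χ x) (hχ0 : ∀ x ≤ 0, χ x = 0) (hE : 0 < E) :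
    ∃ δ₁ a₁ : ℝ, 0 < δ₁ ∧ ∀ δ, 0 < δ → δ < δ₁ → ∀ y,
      IsShellSolution M l L δ a (log (√2 * E)) Φ χ y → y a ≤ a₁ := by
  have ha0 : 0 < a := lt_trans (by positivity) ha
  rcases le_or_gt (4 * M) a with h4 | h4
  · exact ⟨1, log E - 1 / 2 * log (1 - 2 * M / a), one_pos, fun δ hδ _ y h =>
      (ShellSolution.of_isShellSolution hM hl hΦ hΦK hΦ0 hL ha hχ hχn hχ0 hδ.le h).y_le hM hE
        h.2.1 h4⟩
  have hg' : Measurable fun α => Φ α * (1 - α) ^ 2 := hΦ.mul (by fun_prop)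
  have hg0' : ∀ α, 0 ≤ Φ α * (1 - α) ^ 2 := fun α => mul_nonneg (hΦ0 α) (sq_nonneg _)
  have hgpos' : ∀ α ∈ Ioo 0 (min α₀ 1), 0 < Φ α * (1 - α) ^ 2 := fun α hα => by
    have := hΦpos α ⟨hα.1, hα.2.trans_le (min_le_left _ _)⟩
    have h1 : 0 < 1 - α := by linarith [hα.2.trans_le (min_le_right _ _)]
    positivity
  have hs₁ : 0 < l + 1 / 2 := by linarith
  have hs₂ : 0 < l + 3 / 2 := by linarith
  obtain ⟨CG, hCG, hGle⟩ := exists_shellKernel_le (l := l) (n := 3) (b := 4 * M)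
    (cConst_pos hl).le (abs_mul_one_sub_sq_le hΦK) hs₁ hL ha0
  obtain ⟨CH, hCH, hHle⟩ := exists_shellKernel_le (l := l) (n := 1) (b := 4 * M)
    (dConst_pos hl).le hΦK hs₂ hL ha0
  obtain ⟨cG, hcG, hleG⟩ := exists_le_shellKernel (l := l) (n := 3) (b := 4 * M)
    (cConst_pos hl) hg' (abs_mul_one_sub_sq_le hΦK) hg0' (lt_min hα₀ one_pos) hgpos' hs₁ hL ha0
  obtain ⟨cH, hcH, hleH⟩ := exists_le_shellKernel (l := l) (n := 1) (b := 4 * M)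
    (dConst_pos hl) hΦ hΦK hΦ0 hα₀ hΦpos hs₂ hL ha0
  have ew₁ : 3 + 2 * (l + 1 / 2) = 2 * l + 4 := by ring
  have ew₂ : 1 + 2 * (l + 3 / 2) = 2 * l + 4 := by ring
  simp only [ew₁, ew₂] at hGle hHle hleG hleH
  have hd : 0 < 1 - 2 * M / a := by rw [sub_pos, div_lt_one ha0]; exact ha
  obtain ⟨δ₁, a₁, hδ₁, hmain⟩ := ShellSystem.exists_apriori_bound (w := 2 * l + 4)
    (C₁ := max CG CH) (c₁ := min cG cH) (c₀ := 1 / 2) (y₁ := log (8 * (1 + L / a ^ 2)) / 2)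
    ha0 h4 (by linarith) (lt_max_of_lt_left hCG) (lt_min hcG hcH) (by norm_num) hχ hχ0 hχn hd
    (log (√2 * E))
  refine ⟨δ₁, a₁, hδ₁, fun δ hδ hδlt y hy => ?_⟩
  have h := ShellSolution.of_isShellSolution hM hl hΦ hΦK hΦ0 hL ha hχ hχn hχ0 hδ.le hy
  have hsub : ∀ {r}, r ∈ Icc a (4 * M) → r ∈ Ioi (2 * M) := fun hr => ha.trans_le hr.1
  have hupper : ∀ {r C k : ℝ}, C ≤ max CG CH → k ≤ C * exp ((2 * l + 4) * y r) →
      δ * χ (r - a) * k ≤ max CG CH * (δ * χ (r - a) * exp ((2 * l + 4) * y r)) := by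
    intro r C k hC hk
    have := hχn (r - a)
    calc δ * χ (r - a) * k ≤ δ * χ (r - a) * (max CG CH * exp ((2 * l + 4) * y r)) := by
          gcongr
          exact hk.trans (by gcongr)
      _ = _ := by ring
  have hlower : ∀ {r c k : ℝ}, min cG cH ≤ c → c * exp ((2 * l + 4) * y r) ≤ k →
      min cG cH * (δ * χ (r - a) * exp ((2 * l + 4) * y r)) ≤ δ * χ (r - a) * k := by
    intro r c k hc hk
    have := hχn (r - a)
    calc _ = δ * χ (r - a) * (min cG cH * exp ((2 * l + 4) * y r)) := by ring
      _ ≤ δ * χ (r - a) * k := by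
          gcongr
          exact le_trans (by gcongr) hk
  refine hmain δ hδ hδlt (fun r => 1 - 2 / r * (M + mFun M l L δ a Φ χ y r)) y
    (rhoFun l L δ a Φ χ y) (pFun l L δ a Φ χ y) ?_ ?_ hy.2.1.le
  · refine ⟨fun r hr => ?_, fun r hr => ?_, fun r hr => h.D_pos r (hsub hr), fun r hr => ?_,
      fun r hr => h.ρ_nonneg r (hsub hr), fun r hr => h.p_nonneg r (hsub hr), fun r hr => ?_,
      fun r hr => ?_, fun r hr hyr => ?_, fun r hr hyr => ?_⟩
    · have hr0 : 0 < r := ha0.trans_le hr.1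
      have := (h.D_pos r (hsub hr)).ne'
      refine (h.hasDerivAt_y r (hsub hr)).congr_deriv ?_
      rw [neg_mul, inv_mul_eq_div, neg_div]
      congr 3
      field_simp
      ring
    · have hr0 : 0 < r := ha0.trans_le hr.1
      refine (h.hasDerivAt_D hM (hsub hr)).congr_deriv ?_
      field_simp
      ring
    · have hr0 : 0 < r := ha0.trans_le hr.1
      have h1 : 1 / 2 ≤ 2 / r * (M + mFun M l L δ a Φ χ y r) := by
        have hm := h.m_nonneg r (hsub hr)
        rw [div_mul_eq_mul_div, le_div_iff₀ hr0]
        linarith [hr.2]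
      linarith
    · rw [rhoFun, Gfun_eq_shellKernel hl hΦ hΦK hL]
      exact hupper (le_max_left _ _) (hGle r hr (y r))
    · rw [pFun, Hfun_eq_shellKernel hl hΦ hΦK hL]
      exact hupper (le_max_right _ _) (hHle r hr (y r))
    · rw [rhoFun, Gfun_eq_shellKernel hl hΦ hΦK hL]
      exact hlower (min_le_left _ _) (hleG r hr (y r) hyr)
    · rw [pFun, Hfun_eq_shellKernel hl hΦ hΦK hL]
      exact hlower (min_le_right _ _) (hleH r hr (y r) hyr)
  · rw [h.m_eq_zero a le_rfl, add_zero, div_mul_eq_mul_div]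

theorem exists_shellBounds (hM : 0 < M) (hl : -(1/2) < l) (hΦ : Measurable Φ)
    (hΦK : ∀ α ∈ Icc (0:ℝ) 1, |Φ α| ≤ K) (hΦ0 : ∀ x, 0 ≤ Φ x) (hα₀ : 0 < α₀)
    (hΦpos : ∀ x ∈ Ioo 0 α₀, 0 < Φ x) (hL : 0 ≤ L) (ha : 2 * M < a)
    (hχ : ContDiff ℝ (⊤ : ℕ∞) χ) (hχn : ∀ x, 0 ≤ χ x) (hχ0 : ∀ x ≤ 0, χ x = 0) (hE : 0 < E)
    (hE1 : E < 1) :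
    ∃ R C D₁ δ₀ : ℝ, a ≤ R ∧ 0 ≤ C ∧ 0 < D₁ ∧ 0 < δ₀ ∧ ∀ δ, 0 < δ → δ < δ₀ → ∀ y,
      IsShellSolution M l L δ a (log (√2 * E)) Φ χ y →
      ShellBounds M a R C D₁ δ (mFun M l L δ a Φ χ y) (rhoFun l L δ a Φ χ y)
        (pFun l L δ a Φ χ y) (pDeriv l L δ a Φ χ y) := by
  obtain ⟨δ₁, ymax, hδ₁, hymax⟩ :=
    exists_y_le hM hl hΦ hΦK hΦ0 hα₀ hΦpos hL ha hχ hχn hχ0 hE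
  have ha0 : 0 < a := lt_trans (by positivity) ha
  set R := max (max a (4 * M)) (2 * M / (1 - E ^ 2)) with hR
  have haR : a ≤ R := (le_max_left _ _).trans (le_max_left _ _)
  have hMR : 4 * M ≤ R := (le_max_right _ _).trans (le_max_left _ _)
  have hER : 2 * M / (1 - E ^ 2) ≤ R := le_max_right _ _
  have hR0 : 0 < R := ha0.trans_le haR
  have hs₁ : 0 < l + 1 / 2 := by linarith
  have hs₂ : 1 < l + 3 / 2 := by linarith
  obtain ⟨CG, hCG, hGle⟩ := exists_shellKernel_le (l := l) (n := 3) (b := R)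
    (cConst_pos hl).le (abs_mul_one_sub_sq_le hΦK) hs₁ hL ha0
  obtain ⟨CH, hCH, hHle⟩ := exists_shellKernel_le (l := l) (n := 1) (b := R)
    (dConst_pos hl).le hΦK (by linarith : 0 < l + 3 / 2) hL ha0
  obtain ⟨Cχ, hCχ⟩ := (isCompact_Icc (a := 0) (b := R - a)).exists_bound_of_continuousOn
    hχ.continuous.continuousOn
  obtain ⟨Cχ', hCχ'⟩ := (isCompact_Icc (a := 0) (b := R - a)).exists_bound_of_continuousOn
    (hχ.continuous_deriv (by simp)).continuousOn
  set KG := CG * exp ((3 + 2 * (l + 1 / 2)) * ymax)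
  set KH := CH * exp ((1 + 2 * (l + 3 / 2)) * ymax)
  have hχ₀ : 0 ≤ Cχ := (norm_nonneg _).trans (hCχ 0 ⟨le_rfl, by linarith⟩)
  have hχ₀' : 0 ≤ Cχ' := (norm_nonneg _).trans (hCχ' 0 ⟨le_rfl, by linarith⟩)
  set Kρ := Cχ * KG
  set Kp := Cχ * KH
  set Km := 4 * π * (R ^ 2 * Kρ) * (R - a)
  have hRa : 0 ≤ R - a := by linarith
  have hKρ : 0 ≤ Kρ := by positivity
  have hKp : 0 ≤ Kp := by positivity
  have hKm : 0 ≤ Km := by positivity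
  have hd : 0 < 1 - 2 * M / a := by rw [sub_pos, div_lt_one ha0]; exact ha
  set D₁ := (1 - 2 * M / a) / 2 with hD₁
  have hD₁p : 0 < D₁ := by positivity
  set Y₁ := ((M + Km) / a ^ 2 + 4 * π * R * Kp) / D₁
  obtain ⟨Cd, hCd⟩ := exists_abs_shellKernelDeriv_le (c := dConst l) (l := l) (n := 1) hΦ hΦK hs₂
    hL ha0 R ymax Y₁
  set Kd := Cχ' * KH + Cχ * max Cd 0
  have hKd : 0 ≤ Kd := by positivity
  set C := Kρ + Kp + Km + Kd
  set δ₀ := min (min δ₁ 1) (D₁ * a / (2 * (Km + 1)))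
  refine ⟨R, C, D₁, δ₀, haR, by positivity, hD₁p, by positivity, fun δ hδ hδlt y hy => ?_⟩
  have hδ₁' : δ < δ₁ := hδlt.trans_le ((min_le_left _ _).trans (min_le_left _ _))
  have hδ1 : δ ≤ 1 := (hδlt.trans_le ((min_le_left _ _).trans (min_le_right _ _))).le
  have hδm : δ ≤ D₁ * a / (2 * (Km + 1)) := (hδlt.trans_le (min_le_right _ _)).le
  have h := ShellSolution.of_isShellSolution hM hl hΦ hΦK hΦ0 hL ha hχ hχn hχ0 hδ.le hy
  have hyle : ∀ r, a ≤ r → y r ≤ ymax := fun r hr =>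
    (h.antitoneOn_y hM ha (ha.trans_le hr) hr).trans (hymax δ hδ hδ₁' y hy)
  have hχ0' : ∀ x ≤ 0, deriv χ x = 0 := fun x hx => by
    refine IsLocalMin.deriv_eq_zero (Eventually.of_forall fun z => ?_)
    rw [hχ0 x hx]; exact hχn z
  have hzero : ∀ r ∈ Ioi (2 * M), r ≤ a ∨ R ≤ r → rhoFun l L δ a Φ χ y r = 0 ∧
      pFun l L δ a Φ χ y r = 0 ∧ pDeriv l L δ a Φ χ y r = 0 := by
    rintro r - (hr | hr)
    · have hr' : r - a ≤ 0 := by linarith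
      simp [rhoFun, pFun, pDeriv, hχ0 _ hr', hχ0' _ hr']
    · have hyr := h.y_nonpos hM hE hE1 hy.2.1 (hMR.trans hr) (hER.trans hr)
      rw [rhoFun, pFun, pDeriv, Gfun_eq_shellKernel hl hΦ hΦK hL,
        Hfun_eq_shellKernel hl hΦ hΦK hL, shellKernel_eq_zero hs₁ hL hyr,
        shellKernel_eq_zero (by linarith) hL hyr, shellKernelDeriv_eq_zero hs₂ hL hyr]
      simp
  have hGr : ∀ r ∈ Icc a R, Gfun l L Φ r (y r) ≤ KG := fun r hr => by
    rw [Gfun_eq_shellKernel hl hΦ hΦK hL]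
    refine (hGle r hr (y r)).trans ?_
    have := hyle r hr.1
    have : 0 ≤ 3 + 2 * (l + 1 / 2) := by linarith
    simp only [KG]
    gcongr
  have hHr : ∀ r ∈ Icc a R, Hfun l L Φ r (y r) ≤ KH := fun r hr => by
    rw [Hfun_eq_shellKernel hl hΦ hΦK hL]
    refine (hHle r hr (y r)).trans ?_
    have := hyle r hr.1
    have : 0 ≤ 1 + 2 * (l + 3 / 2) := by linarith
    simp only [KH]
    gcongr
  have hHn : ∀ r ∈ Icc a R, 0 ≤ Hfun l L Φ r (y r) := fun r hr => by
    rw [Hfun_eq_shellKernel hl hΦ hΦK hL]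
    exact shellKernel_nonneg (dConst_pos hl).le hΦ0 (ha0.le.trans hr.1) _
  have hχr : ∀ r ∈ Icc a R, χ (r - a) ≤ Cχ := fun r hr =>
    (le_abs_self _).trans (hCχ (r - a) ⟨by linarith [hr.1], by linarith [hr.2]⟩)
  have hcases : ∀ r, r ∈ Icc a R ∨ (r ≤ a ∨ R ≤ r) := fun r => by
    by_cases h1 : r ≤ a
    · exact Or.inr (Or.inl h1)
    · rcases le_total R r with h2 | h2
      · exact Or.inr (Or.inr h2)
      · exact Or.inl ⟨(not_le.1 h1).le, h2⟩
  have hρ : ∀ r ∈ Icc a R, rhoFun l L δ a Φ χ y r ≤ Kρ * δ := fun r hr => by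
    have := hχn (r - a)
    calc rhoFun l L δ a Φ χ y r ≤ δ * Cχ * KG := by
          unfold rhoFun
          refine mul_le_mul_of_nonneg (mul_le_mul_of_nonneg_left (hχr r hr) hδ.le) (hGr r hr)
            (by positivity) (by positivity)
      _ = Kρ * δ := by ring
  have hp : ∀ r ∈ Icc a R, pFun l L δ a Φ χ y r ≤ Kp * δ := fun r hr => by
    have := hχn (r - a)
    calc pFun l L δ a Φ χ y r ≤ δ * Cχ * KH := by
          unfold pFun
          refine mul_le_mul_of_nonneg (mul_le_mul_of_nonneg_left (hχr r hr) hδ.le) (hHr r hr)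
            (by positivity) (by positivity)
      _ = Kp * δ := by ring
  have hsub : Icc a R ⊆ Ioi (2 * M) := fun r hr => ha.trans_le hr.1
  have hmR : ∀ r ∈ Icc a R, mFun M l L δ a Φ χ y r ≤ Km * δ := fun r hr => by
    have := (convex_Icc a R).image_sub_le_mul_sub_of_deriv_le
      (f := mFun M l L δ a Φ χ y) (C := 4 * π * (R ^ 2 * (Kρ * δ)))
      (fun r hr => (h.hasDerivAt_m r (hsub hr)).continuousAt.continuousWithinAt)
      (fun r hr =>
        (h.hasDerivAt_m r (hsub (interior_subset hr))).differentiableAt.differentiableWithinAt)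
      (fun r hr => by
        have hr' := interior_subset hr
        rw [(h.hasDerivAt_m r (hsub hr')).deriv]
        have := h.ρ_nonneg r (hsub hr')
        have := hρ r hr'
        have h0 : 0 ≤ r := ha0.le.trans hr'.1
        have := hr'.2
        gcongr)
      a (left_mem_Icc.2 haR) r hr hr.1
    rw [h.m_eq_zero a le_rfl, sub_zero] at this
    refine this.trans ?_
    calc 4 * π * (R ^ 2 * (Kρ * δ)) * (r - a) ≤ 4 * π * (R ^ 2 * (Kρ * δ)) * (R - a) := by
          have := hr.2
          gcongr
      _ = Km * δ := by ring
  have hm : ∀ r ∈ Ioi (2 * M), mFun M l L δ a Φ χ y r ≤ Km * δ := by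
    intro r hr
    rcases hcases r with h1 | h1 | h1
    · exact hmR r h1
    · rw [h.m_eq_zero r h1]; positivity
    · refine le_trans ?_ (hmR R (right_mem_Icc.2 haR))
      have hsub' : Icc R r ⊆ Ioi (2 * M) := fun s hs => hsub (left_mem_Icc.2 haR) |>.trans_le
        (haR.trans hs.1)
      have := (convex_Icc R r).image_sub_le_mul_sub_of_deriv_le
        (f := mFun M l L δ a Φ χ y) (C := 0)
        (fun r hr => (h.hasDerivAt_m r (hsub' hr)).continuousAt.continuousWithinAt)
        (fun r hr =>
          (h.hasDerivAt_m r (hsub' (interior_subset hr))).differentiableAt.differentiableWithinAt)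
        (fun s hs => by
          have hs' := interior_subset hs
          rw [(h.hasDerivAt_m s (hsub' hs')).deriv, (hzero s (hsub' hs') (Or.inr hs'.1)).1]
          simp)
        R (left_mem_Icc.2 h1) r (right_mem_Icc.2 h1) h1
      linarith
  have hD : ∀ r, a ≤ r → D₁ ≤ 1 - 2 / r * (M + mFun M l L δ a Φ χ y r) := by
    intro r hr
    have hr0 : 0 < r := ha0.trans_le hr
    have hmr := hm r (ha.trans_le hr)
    have h1 : Km * δ ≤ D₁ * a / 2 := by
      calc Km * δ ≤ (Km + 1) * (D₁ * a / (2 * (Km + 1))) := by gcongr; linarith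
        _ = D₁ * a / 2 := by field_simp
    have h2 : 2 / r * (M + mFun M l L δ a Φ χ y r) ≤ 2 / a * (M + D₁ * a / 2) := by
      have := h.m_nonneg r (ha.trans_le hr)
      gcongr
      linarith
    have h3 : 2 / a * (M + D₁ * a / 2) = 2 * M / a + D₁ := by field_simp
    have h4 : 2 * D₁ = 1 - 2 * M / a := by rw [hD₁]; ring
    linarith
  have hp' : ∀ r ∈ Icc a R, |pDeriv l L δ a Φ χ y r| ≤ Kd * δ := by
    intro r hr
    have hrM := hsub hr
    have hr0 : 0 < r := ha0.trans_le hr.1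
    have hz : |deriv y r| ≤ Y₁ := by
      rw [(h.hasDerivAt_y r hrM).deriv, neg_mul, abs_neg, inv_mul_eq_div]
      have hmn := h.m_nonneg r hrM
      have hpn := h.p_nonneg r hrM
      have hDp := h.D_pos r hrM
      rw [abs_of_nonneg (by positivity)]
      have e1 : mFun M l L δ a Φ χ y r ≤ Km :=
        (hm r hrM).trans (mul_le_of_le_one_right hKm hδ1)
      have e2 : pFun l L δ a Φ χ y r ≤ Kp := (hp r hr).trans (mul_le_of_le_one_right hKp hδ1)
      have e3 := hr.1
      have e4 := hr.2
      have e5 := hD r hr.1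
      simp only [Y₁]
      gcongr
    have hsh := hCd r hr (y r) (hyle r hr.1) _ hz
    have e1 : |deriv χ (r - a)| ≤ Cχ' :=
      hCχ' (r - a) ⟨by linarith [hr.1], by linarith [hr.2]⟩
    have e2 : |χ (r - a)| ≤ Cχ := hCχ (r - a) ⟨by linarith [hr.1], by linarith [hr.2]⟩
    have e3 : |Hfun l L Φ r (y r)| ≤ KH := by
      rw [abs_of_nonneg (hHn r hr)]; exact hHr r hr
    unfold pDeriv
    rw [abs_mul, abs_of_pos hδ, mul_comm Kd]
    refine mul_le_mul_of_nonneg_left ((abs_add_le _ _).trans ?_) hδ.le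
    rw [abs_mul, abs_mul]
    have e4 := hsh.trans (le_max_left Cd 0)
    exact add_le_add (mul_le_mul e1 e3 (abs_nonneg _) hχ₀') (mul_le_mul e2 e4 (abs_nonneg _) hχ₀)
  have hCρ : Kρ ≤ C := by linarith
  have hCp : Kp ≤ C := by linarith
  have hCm : Km ≤ C := by linarith
  have hCd' : Kd ≤ C := by linarith
  have hCδ : 0 ≤ C * δ := by positivity
  refine ⟨fun r hr => ?_, fun r hr => ?_, fun r hr => (hm r hr).trans (by gcongr),
    fun r hr => ?_, hzero, hD⟩
  · rcases hcases r with h1 | h1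
    · exact (hρ r h1).trans (by gcongr)
    · rw [(hzero r hr h1).1]; exact hCδ
  · rcases hcases r with h1 | h1
    · exact (hp r h1).trans (by gcongr)
    · rw [(hzero r hr h1).2.1]; exact hCδ
  · rcases hcases r with h1 | h1
    · exact (hp' r h1).trans (by gcongr)
    · rw [(hzero r hr h1).2.2, abs_zero]; exact hCδ

end

/-- `F δ` approximates `f` on `S` with an error of order `δ`, uniformly for `δ ∈ (0, δ₀)`. -/
def UniformlyO (δ₀ : ℝ) (S : Set ℝ) (F : ℝ → ℝ → ℝ) (f : ℝ → ℝ) : Prop :=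
  ∃ C, 0 ≤ C ∧ ∀ δ ∈ Ioo 0 δ₀, ∀ r ∈ S, |F δ r - f r| ≤ C * δ

namespace UniformlyO

variable {δ₀ : ℝ} {S T : Set ℝ} {F G : ℝ → ℝ → ℝ} {f g : ℝ → ℝ}

theorem refl (f : ℝ → ℝ) : UniformlyO δ₀ S (fun _ => f) f :=
  ⟨0, le_rfl, fun _ _ _ _ => by simp⟩

theorem add (hF : UniformlyO δ₀ S F f) (hG : UniformlyO δ₀ S G g) :
    UniformlyO δ₀ S (fun δ r => F δ r + G δ r) (fun r => f r + g r) := by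
  obtain ⟨A, hA0, hA⟩ := hF
  obtain ⟨B, hB0, hB⟩ := hG
  refine ⟨A + B, by positivity, fun δ hδ r hr => ?_⟩
  rw [add_sub_add_comm, add_mul]
  exact (abs_add_le _ _).trans (add_le_add (hA δ hδ r hr) (hB δ hδ r hr))

theorem mul (hF : UniformlyO δ₀ S F f) (hG : UniformlyO δ₀ S G g)
    {A B : ℝ} (hA : ∀ r ∈ S, |f r| ≤ A) (hB : ∀ r ∈ S, |g r| ≤ B) :
    UniformlyO δ₀ S (fun δ r => F δ r * G δ r) (fun r => f r * g r) := by
  obtain ⟨C, hC0, hC⟩ := hF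
  obtain ⟨C', hC0', hC'⟩ := hG
  refine ⟨C * |C' * δ₀| + C * |B| + |A| * C', by positivity, fun δ hδ r hr => ?_⟩
  have hδ0 : 0 ≤ δ := hδ.1.le
  have h1 := hC δ hδ r hr
  have h2 := hC' δ hδ r hr
  have h3 : |G δ r - g r| ≤ |C' * δ₀| :=
    (h2.trans (mul_le_mul_of_nonneg_left hδ.2.le hC0')).trans (le_abs_self _)
  have h4 := (hA r hr).trans (le_abs_self A)
  have h5 := (hB r hr).trans (le_abs_self B)
  have e : F δ r * G δ r - f r * g r = (F δ r - f r) * (G δ r - g r) +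
    (F δ r - f r) * g r + f r * (G δ r - g r) := by ring
  have t1 : |(F δ r - f r) * (G δ r - g r)| ≤ C * δ * |C' * δ₀| := by
    rw [abs_mul]; gcongr
  have t2 : |(F δ r - f r) * g r| ≤ C * δ * |B| := by
    rw [abs_mul]; gcongr
  have t3 : |f r * (G δ r - g r)| ≤ |A| * (C' * δ) := by
    rw [abs_mul]; gcongr
  rw [e]
  refine (abs_add_three _ _ _).trans ?_
  linarith

theorem const_mul (hF : UniformlyO δ₀ S F f) {g : ℝ → ℝ} {B : ℝ} (hB : ∀ r ∈ S, |g r| ≤ B) :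
    UniformlyO δ₀ S (fun δ r => g r * F δ r) (fun r => g r * f r) := by
  obtain ⟨C, hC0, hC⟩ := hF
  refine ⟨|B| * C, by positivity, fun δ hδ r hr => ?_⟩
  rw [← mul_sub, abs_mul, mul_assoc]
  have h1 := hC δ hδ r hr
  have h2 := (hB r hr).trans (le_abs_self B)
  gcongr

theorem inv (hF : UniformlyO δ₀ S F f) {d : ℝ} (hd : 0 < d)
    (hFd : ∀ δ ∈ Ioo 0 δ₀, ∀ r ∈ S, d ≤ F δ r) (hfd : ∀ r ∈ S, d ≤ f r) :
    UniformlyO δ₀ S (fun δ r => (F δ r)⁻¹) (fun r => (f r)⁻¹) := by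
  obtain ⟨C, hC0, hC⟩ := hF
  refine ⟨C / (d * d), by positivity, fun δ hδ r hr => ?_⟩
  have h1 := hFd δ hδ r hr
  have h2 := hfd r hr
  have h1' := hd.trans_le h1
  have h2' := hd.trans_le h2
  have hδ0 : 0 ≤ δ := hδ.1.le
  have h3 := hC δ hδ r hr
  rw [abs_sub_comm] at h3
  rw [inv_sub_inv h1'.ne' h2'.ne', abs_div, abs_of_pos (mul_pos h1' h2'), div_mul_eq_mul_div]
  gcongr

theorem log (hF : UniformlyO δ₀ S F f) {d : ℝ} (hd : 0 < d)
    (hFd : ∀ δ ∈ Ioo 0 δ₀, ∀ r ∈ S, d ≤ F δ r) (hfd : ∀ r ∈ S, d ≤ f r) :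
    UniformlyO δ₀ S (fun δ r => Real.log (F δ r)) (fun r => Real.log (f r)) := by
  obtain ⟨C, hC0, hC⟩ := hF
  have key : ∀ x y : ℝ, d ≤ x → d ≤ y → Real.log x - Real.log y ≤ |x - y| / d := by
    intro x y hx hy
    have hx0 := hd.trans_le hx
    have hy0 := hd.trans_le hy
    rw [← log_div hx0.ne' hy0.ne']
    calc Real.log (x / y) ≤ x / y - 1 := log_le_sub_one_of_pos (by positivity)
      _ = (x - y) / y := by field_simp
      _ ≤ |x - y| / d := by gcongr; exact le_abs_self _
  refine ⟨C / d, by positivity, fun δ hδ r hr => ?_⟩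
  have h1 := hFd δ hδ r hr
  have h2 := hfd r hr
  have h3 : |F δ r - f r| / d ≤ C / d * δ := by
    rw [div_mul_eq_mul_div]; gcongr; exact hC δ hδ r hr
  have h4 := key _ _ h1 h2
  have h5 := key _ _ h2 h1
  rw [abs_sub_comm] at h5
  exact abs_le.2 ⟨by linarith, by linarith⟩

theorem of_eq_on (hF : UniformlyO δ₀ S F f)
    (hT : ∀ δ ∈ Ioo 0 δ₀, ∀ r ∈ T, r ∉ S → F δ r = f r) : UniformlyO δ₀ T F f := by
  obtain ⟨C, hC0, hC⟩ := hF
  refine ⟨C, hC0, fun δ hδ r hr => ?_⟩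
  by_cases hrS : r ∈ S
  · exact hC δ hδ r hrS
  · rw [hT δ hδ r hr hrS, sub_self, abs_zero]
    exact mul_nonneg hC0 hδ.1.le

theorem congr (hF : UniformlyO δ₀ S F f) (hFG : ∀ δ ∈ Ioo 0 δ₀, ∀ r ∈ S, F δ r = G δ r)
    (hfg : ∀ r ∈ S, f r = g r) : UniformlyO δ₀ S G g := by
  obtain ⟨C, hC0, hC⟩ := hF
  refine ⟨C, hC0, fun δ hδ r hr => ?_⟩
  rw [← hFG δ hδ r hr, ← hfg r hr]
  exact hC δ hδ r hr

theorem tendstoUniformlyOn (hF : UniformlyO δ₀ S F f) (hδ₀ : 0 < δ₀) :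
    TendstoUniformlyOn F f (𝓝[>] 0) S := by
  obtain ⟨C, hC0, hC⟩ := hF
  rw [Metric.tendstoUniformlyOn_iff]
  intro ε hε
  have hpos : 0 < min δ₀ (ε / (C + 1)) := by positivity
  refine eventually_of_mem (Ioo_mem_nhdsGT hpos) fun δ hδ r hr => ?_
  rw [dist_comm, Real.dist_eq]
  have h1 : δ < δ₀ := hδ.2.trans_le (min_le_left _ _)
  have h2 : δ < ε / (C + 1) := hδ.2.trans_le (min_le_right _ _)
  rw [lt_div_iff₀ (by positivity)] at h2
  have h3 := hC δ ⟨hδ.1, h1⟩ r hr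
  have := hδ.1
  linarith

end UniformlyO

theorem abs_sub_le_div_of_abs_deriv_le {f f' : ℝ → ℝ} {b K v : ℝ} (hb : 0 ≤ b)
    (hd : ∀ r ∈ Ioi b, HasDerivAt f (f' r) r) (hK : ∀ r ∈ Ioi b, |f' r| ≤ K / r ^ 2)
    (hv : Tendsto f atTop (𝓝 v)) {r : ℝ} (hr : r ∈ Ioi b) : |f r - v| ≤ K / r := by
  have hinv : ∀ s ∈ Ioi b, HasDerivAt (fun r => K / r) (-(K / s ^ 2)) s := fun s hs => by
    have hs0 : s ≠ 0 := (hb.trans_lt hs).ne'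
    refine ((hasDerivAt_inv hs0).const_mul K).congr_deriv ?_
    field_simp
  have hlim : Tendsto (fun r => K / r) atTop (𝓝 0) := tendsto_const_nhds.div_atTop tendsto_id
  have hplus : AntitoneOn (fun r => f r + K / r) (Ioi b) :=
    antitoneOn_of_deriv_nonpos (convex_Ioi _)
      (fun s hs => ((hd s hs).add (hinv s hs)).continuousAt.continuousWithinAt)
      (fun s hs => ((hd s (interior_subset hs)).add
        (hinv s (interior_subset hs))).differentiableAt.differentiableWithinAt)
      (fun s hs => by
        have hs' := interior_subset hs
        have h := ((hd s hs').add (hinv s hs')).deriv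
        change deriv (fun r => f r + K / r) s = _ at h
        rw [h]
        linarith [(abs_le.1 (hK s hs')).2])
  have hminus : MonotoneOn (fun r => f r - K / r) (Ioi b) :=
    monotoneOn_of_deriv_nonneg (convex_Ioi _)
      (fun s hs => ((hd s hs).sub (hinv s hs)).continuousAt.continuousWithinAt)
      (fun s hs => ((hd s (interior_subset hs)).sub
        (hinv s (interior_subset hs))).differentiableAt.differentiableWithinAt)
      (fun s hs => by
        have hs' := interior_subset hs
        have h := ((hd s hs').sub (hinv s hs')).deriv
        change deriv (fun r => f r - K / r) s = _ at h
        rw [h]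
        linarith [(abs_le.1 (hK s hs')).1])
  have h1 : v + 0 ≤ f r + K / r := le_of_tendsto (hv.add hlim)
    ((eventually_ge_atTop r).mono fun s hs => hplus hr (lt_of_lt_of_le hr hs) hs)
  have h2 : f r - K / r ≤ v - 0 := ge_of_tendsto (hv.sub hlim)
    ((eventually_ge_atTop r).mono fun s hs => hminus hr (lt_of_lt_of_le hr hs) hs)
  exact abs_le.2 ⟨by linarith, by linarith⟩

theorem iteratedDeriv_two_eq_of_hasDerivAt {f f₁ f₂ : ℝ → ℝ} {s : Set ℝ} (hs : IsOpen s)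
    (h₁ : ∀ r ∈ s, HasDerivAt f (f₁ r) r) (h₂ : ∀ r ∈ s, HasDerivAt f₁ (f₂ r) r) {r : ℝ}
    (hr : r ∈ s) : iteratedDeriv 2 f r = f₂ r := by
  rw [iteratedDeriv_succ, iteratedDeriv_one]
  refine ((h₂ r hr).congr_of_eventuallyEq ?_).deriv
  exact eventually_of_mem (hs.mem_nhds hr) fun z hz => (h₁ z hz).deriv

theorem contDiffOn_two_of_hasDerivAt {f f₁ f₂ : ℝ → ℝ} {s : Set ℝ} (hs : IsOpen s)
    (h₁ : ∀ r ∈ s, HasDerivAt f (f₁ r) r) (h₂ : ∀ r ∈ s, HasDerivAt f₁ (f₂ r) r)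
    (hf₂ : ContinuousOn f₂ s) : ContDiffOn ℝ 2 f s := by
  have e₁ : ContDiffOn ℝ 1 f₁ s := by
    refine (contDiffOn_one_iff_derivWithin hs.uniqueDiffOn).2
      ⟨fun r hr => (h₂ r hr).differentiableAt.differentiableWithinAt, ?_⟩
    exact hf₂.congr fun r hr => (h₂ r hr).hasDerivWithinAt.derivWithin (hs.uniqueDiffOn r hr)
  rw [show (2 : WithTop ℕ∞) = 1 + 1 by norm_num, contDiffOn_succ_iff_deriv_of_isOpen hs]
  refine ⟨fun r hr => (h₁ r hr).differentiableAt.differentiableWithinAt, by simp, ?_⟩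
  exact e₁.congr fun r hr => (h₁ r hr).deriv

/-- The radial derivative of the metric potential. -/
def shellSlope (M : ℝ) (m p : ℝ → ℝ) (r : ℝ) : ℝ :=
  (1 - 2 / r * (M + m r))⁻¹ * ((M + m r) / r ^ 2 + 4 * π * r * p r)

/-- The second radial derivative of the metric potential. -/
def shellCurvature (M : ℝ) (m ρ p p' : ℝ → ℝ) (r : ℝ) : ℝ :=
  (1 - 2 / r * (M + m r))⁻¹ *
    (4 * π * ρ r - 2 * (M + m r) / r ^ 3 + 4 * π * p r + 4 * π * r * p' r -
      shellSlope M m p r * (2 * (M + m r) / r ^ 2 - 8 * π * r * ρ r))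

namespace ShellSolution

variable {M a : ℝ} {y m ρ p p' : ℝ → ℝ}

theorem schwarzschild (hM : 0 < M) :
    ShellSolution M a (fun r => -(1 / 2 * Real.log (1 - 2 * M / r)))
      (fun _ => 0) (fun _ => 0) (fun _ => 0) (fun _ => 0) where
  hasDerivAt_y r hr := by
    refine (hasDerivAt_half_log_lapse hM hr).neg.congr_deriv ?_
    rw [add_zero, mul_zero, add_zero, div_mul_eq_mul_div, neg_mul, inv_mul_eq_div]
  hasDerivAt_m r _ := by simpa using hasDerivAt_const r (0:ℝ)
  hasDerivAt_p r _ := hasDerivAt_const r 0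
  continuousOn_ρ := continuousOn_const
  continuousOn_p' := continuousOn_const
  D_pos r hr := by
    have hr' : 2 * M < r := hr
    have hr0 : 0 < r := lt_trans (by positivity) hr'
    rw [add_zero, sub_pos, div_mul_eq_mul_div, div_lt_one hr0]
    exact hr'
  ρ_nonneg _ _ := le_rfl
  p_nonneg _ _ := le_rfl
  m_nonneg _ _ := le_rfl
  m_eq_zero _ _ := rfl

theorem hasDerivAt_const_sub (h : ShellSolution M a y m ρ p p') (c : ℝ) :
    ∀ r ∈ Ioi (2 * M), HasDerivAt (fun r => c - y r) (shellSlope M m p r) r := fun r hr => by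
  refine ((h.hasDerivAt_y r hr).const_sub c).congr_deriv ?_
  rw [neg_mul, neg_neg, shellSlope]

theorem hasDerivAt_shellSlope (h : ShellSolution M a y m ρ p p') (hM : 0 < M) :
    ∀ r ∈ Ioi (2 * M), HasDerivAt (shellSlope M m p) (shellCurvature M m ρ p p' r) r := by
  intro r hr
  have hr0 : 0 < r := lt_trans (by positivity) (mem_Ioi.1 hr)
  have hD := (h.D_pos r hr).ne'
  have h1 := (h.hasDerivAt_D hM hr).inv hD
  have h2 := ((h.hasDerivAt_m r hr).const_add M).div (hasDerivAt_pow 2 r) (pow_ne_zero 2 hr0.ne')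
  have h3 := ((hasDerivAt_id r).const_mul (4 * π)).mul (h.hasDerivAt_p r hr)
  refine (h1.mul (h2.add h3)).congr_deriv ?_
  simp only [shellCurvature, shellSlope, Pi.add_apply, Pi.mul_apply, Pi.div_apply, Pi.inv_apply, id]
  generalize 1 - 2 / r * (M + m r) = D at hD
  field_simp
  push_cast
  ring

theorem continuousOn_shellCurvature (h : ShellSolution M a y m ρ p p') (hM : 0 < M) :
    ContinuousOn (shellCurvature M m ρ p p') (Ioi (2 * M)) := by
  have hr0 : ∀ {r}, r ∈ Ioi (2 * M) → 0 < r := fun hr =>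
    lt_trans (by positivity) (mem_Ioi.1 hr)
  have hs : ContinuousOn (shellSlope M m p) (Ioi (2 * M)) := fun r hr =>
    (h.hasDerivAt_shellSlope hM r hr).continuousAt.continuousWithinAt
  have hm : ContinuousOn m (Ioi (2 * M)) := fun r hr =>
    (h.hasDerivAt_m r hr).continuousAt.continuousWithinAt
  have hp : ContinuousOn p (Ioi (2 * M)) := fun r hr =>
    (h.hasDerivAt_p r hr).continuousAt.continuousWithinAt
  have hD : ContinuousOn (fun r => 1 - 2 / r * (M + m r)) (Ioi (2 * M)) := fun r hr =>
    (h.hasDerivAt_D hM hr).continuousAt.continuousWithinAt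
  have hρ := h.continuousOn_ρ
  have hp' := h.continuousOn_p'
  have hq : ∀ n : ℕ, ContinuousOn (fun r => 2 * (M + m r) / r ^ n) (Ioi (2 * M)) := fun n =>
    ContinuousOn.div (by fun_prop) (by fun_prop) fun r hr => pow_ne_zero n (hr0 hr).ne'
  unfold shellCurvature
  refine (hD.inv₀ fun r hr => (h.D_pos r hr).ne').mul ?_
  exact (((ContinuousOn.sub (by fun_prop) (hq 3)).add (by fun_prop)).add (by fun_prop)).sub
    (hs.mul ((hq 2).sub (by fun_prop)))

end ShellSolution

section

variable {M a R C D₁ δ₀ : ℝ} {y m ρ p p' : ℝ → ℝ → ℝ}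

/-- Common data: solutions for all `δ ∈ (0, δ₀)` with uniform bounds. -/
structure ShellFamily (M a R C D₁ δ₀ : ℝ) (y m ρ p p' : ℝ → ℝ → ℝ) : Prop where
  M_pos : 0 < M
  lt_a : 2 * M < a
  a_le : a ≤ R
  C_nonneg : 0 ≤ C
  D₁_pos : 0 < D₁
  δ₀_pos : 0 < δ₀
  sol : ∀ δ ∈ Ioo 0 δ₀, ShellSolution M a (y δ) (m δ) (ρ δ) (p δ) (p' δ)
  bd : ∀ δ ∈ Ioo 0 δ₀, ShellBounds M a R C D₁ δ (m δ) (ρ δ) (p δ) (p' δ)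

namespace ShellFamily

theorem a_pos (h : ShellFamily M a R C D₁ δ₀ y m ρ p p') : 0 < a :=
  lt_trans (mul_pos two_pos h.M_pos) h.lt_a

theorem uniformlyO_m (h : ShellFamily M a R C D₁ δ₀ y m ρ p p') :
    UniformlyO δ₀ (Ioi (2 * M)) m (fun _ => 0) :=
  ⟨C, h.C_nonneg, fun δ hδ r hr => by
    rw [sub_zero, abs_of_nonneg ((h.sol δ hδ).m_nonneg r hr)]
    exact (h.bd δ hδ).m_le r hr⟩

theorem uniformlyO_ρ (h : ShellFamily M a R C D₁ δ₀ y m ρ p p') :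
    UniformlyO δ₀ (Ioi (2 * M)) ρ (fun _ => 0) :=
  ⟨C, h.C_nonneg, fun δ hδ r hr => by
    rw [sub_zero, abs_of_nonneg ((h.sol δ hδ).ρ_nonneg r hr)]
    exact (h.bd δ hδ).ρ_le r hr⟩

theorem uniformlyO_p (h : ShellFamily M a R C D₁ δ₀ y m ρ p p') :
    UniformlyO δ₀ (Ioi (2 * M)) p (fun _ => 0) :=
  ⟨C, h.C_nonneg, fun δ hδ r hr => by
    rw [sub_zero, abs_of_nonneg ((h.sol δ hδ).p_nonneg r hr)]
    exact (h.bd δ hδ).p_le r hr⟩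

theorem uniformlyO_p' (h : ShellFamily M a R C D₁ δ₀ y m ρ p p') :
    UniformlyO δ₀ (Ioi (2 * M)) p' (fun _ => 0) :=
  ⟨C, h.C_nonneg, fun δ hδ r hr => by
    rw [sub_zero]
    exact (h.bd δ hδ).abs_p'_le r hr⟩

theorem uniformlyO_pow_mul (h : ShellFamily M a R C D₁ δ₀ y m ρ p p') {F : ℝ → ℝ → ℝ}
    (hF : UniformlyO δ₀ (Ioi (2 * M)) F (fun _ => 0))
    (hF0 : ∀ δ ∈ Ioo 0 δ₀, ∀ r ∈ Ioi (2 * M), R ≤ r → F δ r = 0) (n : ℕ) :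
    UniformlyO δ₀ (Ioi (2 * M)) (fun δ r => r ^ n * F δ r) (fun _ => 0) := by
  obtain ⟨K, hK0, hK⟩ := hF
  have hR : 0 ≤ R := h.a_pos.le.trans h.a_le
  refine ⟨R ^ n * K, by positivity, fun δ hδ r hr => ?_⟩
  have hδ0 := hδ.1
  rcases le_total R r with h1 | h1
  · change |r ^ n * F δ r - 0| ≤ _
    rw [hF0 δ hδ r hr h1]
    simp only [mul_zero, sub_zero, abs_zero]
    positivity
  · have hr0 : 0 ≤ r := le_trans (mul_pos two_pos h.M_pos).le (le_of_lt hr)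
    have h2 := hK δ hδ r hr
    rw [sub_zero] at h2
    rw [sub_zero, abs_mul, abs_of_nonneg (pow_nonneg hr0 n), mul_assoc]
    gcongr

theorem div_pow_le (h : ShellFamily M a R C D₁ δ₀ y m ρ p p') (A : ℝ) (n : ℕ) {r : ℝ}
    (hr : r ∈ Ici a) : |A / r ^ n| ≤ |A| / a ^ n := by
  have := h.a_pos
  have h1 : a ≤ r := hr
  have h2 : 0 < r := this.trans_le h1
  rw [abs_div, abs_of_pos (pow_pos h2 n)]
  gcongr

theorem mono {F : ℝ → ℝ → ℝ} {f : ℝ → ℝ} (h : ShellFamily M a R C D₁ δ₀ y m ρ p p')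
    (hF : UniformlyO δ₀ (Ioi (2 * M)) F f) : UniformlyO δ₀ (Ici a) F f :=
  hF.of_eq_on fun _ _ _ hr hn => absurd (h.lt_a.trans_le hr) hn

theorem uniformlyO_mass_div_pow (h : ShellFamily M a R C D₁ δ₀ y m ρ p p') (A : ℝ) (n : ℕ) :
    UniformlyO δ₀ (Ici a) (fun δ r => A * (M + m δ r) / r ^ n)
      (fun r => A * (M + 0) / r ^ n) :=
  (((UniformlyO.refl fun _ => M).add (h.mono h.uniformlyO_m)).const_mul
    (fun _ hr => h.div_pow_le A n hr)).congr (fun _ _ _ _ => by ring) (fun _ _ => by ring)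

theorem uniformlyO_D (h : ShellFamily M a R C D₁ δ₀ y m ρ p p') :
    UniformlyO δ₀ (Ici a) (fun δ r => 1 - 2 / r * (M + m δ r))
      (fun r => 1 - 2 / r * (M + 0)) :=
  ((UniformlyO.refl fun _ => (1:ℝ)).add (h.uniformlyO_mass_div_pow (-2) 1)).congr
    (fun _ _ _ _ => by ring) (fun _ _ => by ring)

theorem le_D₀ (h : ShellFamily M a R C D₁ δ₀ y m ρ p p') {r : ℝ} (hr : r ∈ Ici a) :
    D₁ ≤ 1 - 2 / r * (M + 0) := by
  have hδ : δ₀ / 2 ∈ Ioo 0 δ₀ := ⟨half_pos h.δ₀_pos, half_lt_self h.δ₀_pos⟩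
  refine ((h.bd _ hδ).le_D r hr).trans ?_
  have h1 := (h.sol _ hδ).m_nonneg r (h.lt_a.trans_le hr)
  have h2 : 0 < r := h.a_pos.trans_le hr
  gcongr

theorem uniformlyO_inv_D (h : ShellFamily M a R C D₁ δ₀ y m ρ p p') :
    UniformlyO δ₀ (Ici a) (fun δ r => (1 - 2 / r * (M + m δ r))⁻¹)
      (fun r => (1 - 2 / r * (M + 0))⁻¹) :=
  h.uniformlyO_D.inv h.D₁_pos (fun δ hδ r hr => (h.bd δ hδ).le_D r hr) fun _ hr => h.le_D₀ hr

theorem abs_inv_D₀_le (h : ShellFamily M a R C D₁ δ₀ y m ρ p p') {r : ℝ} (hr : r ∈ Ici a) :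
    |(1 - 2 / r * (M + 0))⁻¹| ≤ D₁⁻¹ := by
  have h1 := h.le_D₀ hr
  have h2 := h.D₁_pos
  rw [abs_of_pos (inv_pos.2 (h2.trans_le h1))]
  gcongr

theorem uniformlyO_log_D (h : ShellFamily M a R C D₁ δ₀ y m ρ p p') :
    UniformlyO δ₀ (Ioi (2 * M)) (fun δ r => Real.log (1 - 2 / r * (M + m δ r)))
      (fun r => Real.log (1 - 2 / r * (M + 0))) :=
  (h.uniformlyO_D.log h.D₁_pos (fun δ hδ r hr => (h.bd δ hδ).le_D r hr)
    fun _ hr => h.le_D₀ hr).of_eq_on fun δ hδ r _ hn => by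
      rw [(h.sol δ hδ).m_eq_zero r (le_of_not_ge hn)]

theorem uniformlyO_sq_mul_shellSlope (h : ShellFamily M a R C D₁ δ₀ y m ρ p p') :
    UniformlyO δ₀ (Ioi (2 * M)) (fun δ r => r ^ 2 * shellSlope M (m δ) (p δ) r)
      (fun r => r ^ 2 * shellSlope M (fun _ => 0) (fun _ => 0) r) := by
  have hp := h.mono (h.uniformlyO_pow_mul h.uniformlyO_p
    (fun δ hδ r hr hR => ((h.bd δ hδ).eq_zero r hr (Or.inr hR)).2.1) 3)
  have hN := ((UniformlyO.refl fun _ => M).add (h.mono h.uniformlyO_m)).add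
    (hp.const_mul (g := fun _ => 4 * π) (B := |4 * π|) fun _ _ => le_rfl)
  have hprod := h.uniformlyO_inv_D.mul hN (A := D₁⁻¹) (B := |M|)
    (fun _ hr => h.abs_inv_D₀_le hr) (fun _ _ => by simp)
  refine UniformlyO.of_eq_on (hprod.congr (fun δ _ r hr => ?_) fun r hr => ?_)
    fun δ hδ r hr hn => ?_
  · have hr0 : r ≠ 0 := (h.a_pos.trans_le hr).ne'
    unfold shellSlope
    rw [mul_left_comm (r ^ 2)]
    congr 1
    field_simp
  · have hr0 : r ≠ 0 := (h.a_pos.trans_le hr).ne'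
    unfold shellSlope
    rw [mul_left_comm (r ^ 2)]
    congr 1
    field_simp
    ring
  · have hra : r ≤ a := le_of_not_ge hn
    simp only [shellSlope, (h.sol δ hδ).m_eq_zero r hra,
      ((h.bd δ hδ).eq_zero r hr (Or.inl hra)).2.1]

theorem uniformlyO_shellSlope (h : ShellFamily M a R C D₁ δ₀ y m ρ p p') :
    UniformlyO δ₀ (Ioi (2 * M)) (fun δ r => shellSlope M (m δ) (p δ) r)
      (fun r => shellSlope M (fun _ => 0) (fun _ => 0) r) := by
  have hM := h.M_pos
  have hr0 : ∀ r ∈ Ioi (2 * M), 0 < r := fun r hr => lt_trans (by positivity) (mem_Ioi.1 hr)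
  refine (h.uniformlyO_sq_mul_shellSlope.const_mul (g := fun r => 1 / r ^ 2)
    (B := 1 / (2 * M) ^ 2) fun r hr => ?_).congr (fun δ _ r hr => ?_) fun r hr => ?_
  · have hr' : 2 * M < r := hr
    have := hr0 r hr
    rw [abs_of_nonneg (by positivity)]
    gcongr
  · have := hr0 r hr
    field_simp
  · have := hr0 r hr
    field_simp

theorem uniformlyO_shellCurvature (h : ShellFamily M a R C D₁ δ₀ y m ρ p p') :
    UniformlyO δ₀ (Ioi (2 * M)) (fun δ r => shellCurvature M (m δ) (ρ δ) (p δ) (p' δ) r)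
      (fun r => shellCurvature M (fun _ => 0) (fun _ => 0) (fun _ => 0) (fun _ => 0) r) := by
  have hc : ∀ c : ℝ, ∀ r ∈ Ici a, |(fun _ : ℝ => c) r| ≤ |c| := fun _ _ _ => le_rfl
  have hp' := (h.mono (h.uniformlyO_pow_mul h.uniformlyO_p'
    (fun δ hδ r hr hR => ((h.bd δ hδ).eq_zero r hr (Or.inr hR)).2.2) 1)).const_mul (hc (4 * π))
  have hrρ := (h.mono (h.uniformlyO_pow_mul h.uniformlyO_ρ
    (fun δ hδ r hr hR => ((h.bd δ hδ).eq_zero r hr (Or.inr hR)).1) 1)).const_mul (hc (-(8 * π)))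
  have hρ := (h.mono h.uniformlyO_ρ).const_mul (hc (4 * π))
  have hp := (h.mono h.uniformlyO_p).const_mul (hc (4 * π))
  have hD' := (h.uniformlyO_mass_div_pow 2 2).add hrρ
  have hS₀ : ∀ r ∈ Ici a, |shellSlope M (fun _ => 0) (fun _ => 0) r| ≤ D₁⁻¹ * (|M| / a ^ 2) := by
    intro r hr
    have h1 := h.abs_inv_D₀_le hr
    have h2 := h.div_pow_le M 2 hr
    have := h.D₁_pos
    unfold shellSlope
    rw [abs_mul, mul_zero, add_zero, add_zero]
    rw [add_zero] at h1
    gcongr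
  have hD'₀ : ∀ r ∈ Ici a, |2 * (M + 0) / r ^ 2 + -(8 * π) * 0| ≤ |2 * (M + 0)| / a ^ 2 := by
    intro r hr
    rw [mul_zero, add_zero (2 * (M + 0) / r ^ 2)]
    exact h.div_pow_le _ 2 hr
  have hSD := ((h.mono h.uniformlyO_shellSlope).mul hD' hS₀ hD'₀).const_mul (hc (-1))
  have hnum := (((hρ.add (h.uniformlyO_mass_div_pow (-2) 3)).add hp).add hp').add hSD
  have hnum₀ : ∀ r ∈ Ici a, |4 * π * 0 + -2 * (M + 0) / r ^ 3 + 4 * π * 0 + 4 * π * 0 +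
      -1 * (shellSlope M (fun _ => 0) (fun _ => 0) r *
        (2 * (M + 0) / r ^ 2 + -(8 * π) * 0))| ≤
      |-2 * (M + 0)| / a ^ 3 + D₁⁻¹ * (|M| / a ^ 2) * (|2 * (M + 0)| / a ^ 2) := by
    intro r hr
    have h1 := h.div_pow_le (-2 * (M + 0)) 3 hr
    have h2 := mul_le_mul (hS₀ r hr) (hD'₀ r hr) (abs_nonneg _)
      ((abs_nonneg _).trans (hS₀ r hr))
    rw [← abs_mul] at h2
    have e : ∀ x z : ℝ, 4 * π * 0 + x + 4 * π * 0 + 4 * π * 0 + -1 * z = x - z := fun x z => by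
      ring
    rw [e]
    exact (abs_sub _ _).trans (add_le_add h1 h2)
  have hfin := h.uniformlyO_inv_D.mul hnum (fun _ hr => h.abs_inv_D₀_le hr) hnum₀
  refine UniformlyO.of_eq_on (hfin.congr (fun δ _ r _ => ?_) fun r _ => ?_)
    fun δ hδ r hr hn => ?_
  · unfold shellCurvature; ring
  · unfold shellCurvature; ring
  · have hra : r ≤ a := le_of_not_ge hn
    obtain ⟨h1, h2, h3⟩ := (h.bd δ hδ).eq_zero r hr (Or.inl hra)
    simp only [shellCurvature, shellSlope, (h.sol δ hδ).m_eq_zero r hra, h1, h2, h3]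

end ShellFamily

end

namespace ShellFamily

variable {M a R C D₁ δ₀ : ℝ} {y m ρ p p' : ℝ → ℝ → ℝ}

theorem uniformlyO_potential (h : ShellFamily M a R C D₁ δ₀ y m ρ p p') {yinf : ℝ → ℝ}
    (hy : ∀ δ ∈ Ioo 0 δ₀, Tendsto (y δ) atTop (𝓝 (yinf δ))) :
    UniformlyO δ₀ (Ioi (2 * M)) (fun δ r => yinf δ - y δ r)
      (fun r => 1 / 2 * Real.log (1 - 2 * M / r)) := by
  have hM := h.M_pos
  obtain ⟨K, hK0, hK⟩ := h.uniformlyO_sq_mul_shellSlope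
  refine ⟨K / (2 * M), by positivity, fun δ hδ r hr => ?_⟩
  have hr' : 2 * M < r := hr
  have hδ0 := hδ.1
  have hlog : Tendsto (fun r : ℝ => 1 / 2 * Real.log (1 - 2 * M / r)) atTop (𝓝 0) := by
    have h1 : Tendsto (fun r : ℝ => 1 - 2 * M / r) atTop (𝓝 (1 - 0)) :=
      tendsto_const_nhds.sub (tendsto_const_nhds.div_atTop tendsto_id)
    have h2 := (h1.log (by norm_num)).const_mul (1 / 2)
    simpa using h2
  have hd : ∀ s ∈ Ioi (2 * M), HasDerivAt
      (fun s => (yinf δ - y δ s) - (0 - -(1 / 2 * Real.log (1 - 2 * M / s))))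
      (shellSlope M (m δ) (p δ) s - shellSlope M (fun _ => 0) (fun _ => 0) s) s := fun s hs =>
    ((h.sol δ hδ).hasDerivAt_const_sub _ s hs).sub
      ((ShellSolution.schwarzschild (a := a) hM).hasDerivAt_const_sub 0 s hs)
  have hb : ∀ s ∈ Ioi (2 * M),
      |shellSlope M (m δ) (p δ) s - shellSlope M (fun _ => 0) (fun _ => 0) s| ≤
        K * δ / s ^ 2 := fun s hs => by
    have hs0 : 0 < s := lt_trans (by positivity) (mem_Ioi.1 hs)
    have h1 := hK δ hδ s hs
    rw [← mul_sub, abs_mul, abs_of_pos (pow_pos hs0 2)] at h1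
    rwa [le_div_iff₀ (by positivity), mul_comm]
  have hlim : Tendsto
      (fun s => (yinf δ - y δ s) - (0 - -(1 / 2 * Real.log (1 - 2 * M / s)))) atTop (𝓝 0) := by
    have h1 := ((hy δ hδ).const_sub (yinf δ)).sub hlog
    simpa using h1
  have h1 := abs_sub_le_div_of_abs_deriv_le (by positivity) hd hb hlim hr
  rw [zero_sub, neg_neg, sub_zero] at h1
  refine h1.trans ?_
  rw [div_mul_eq_mul_div]
  gcongr

theorem tendsto_exp_limit (h : ShellFamily M a R C D₁ δ₀ y m ρ p p') {yinf : ℝ → ℝ} {E : ℝ}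
    (hE : 0 < E) (hy : ∀ δ ∈ Ioo 0 δ₀, Tendsto (y δ) atTop (𝓝 (yinf δ)))
    (hy₀ : ∀ δ ∈ Ioo 0 δ₀, y δ (4 * M) = Real.log (√2 * E)) :
    Tendsto (fun δ => Real.exp (yinf δ)) (𝓝[>] 0) (𝓝 E) := by
  have hM := h.M_pos
  have h4 : 4 * M ∈ Ioi (2 * M) := by simp only [mem_Ioi]; linarith
  have h1 := ((h.uniformlyO_potential hy).tendstoUniformlyOn h.δ₀_pos).tendsto_at h4
  have h2 := h1.add_const (Real.log (√2 * E))
  have h3 : Tendsto yinf (𝓝[>] 0)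
      (𝓝 (1 / 2 * Real.log (1 - 2 * M / (4 * M)) + Real.log (√2 * E))) := by
    refine h2.congr' (eventually_of_mem (Ioo_mem_nhdsGT h.δ₀_pos) fun δ hδ => ?_)
    rw [← hy₀ δ hδ, sub_add_cancel]
  have e : 1 / 2 * Real.log (1 - 2 * M / (4 * M)) + Real.log (√2 * E) = Real.log E := by
    have : 1 - 2 * M / (4 * M) = (2 : ℝ)⁻¹ := by field_simp; norm_num
    rw [this, log_inv, log_mul (by positivity) hE.ne', log_sqrt (by norm_num)]
    ring
  rw [e] at h3
  simpa only [exp_log hE] using h3.rexp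

theorem tendsto_shell_mass (h : ShellFamily M a R C D₁ δ₀ y m ρ p p') {b c : ℝ}
    (hb : 2 * M ≤ b) (hbc : b ≤ c) :
    Tendsto (fun δ => 4 * π * ∫ s in b..c, s ^ 2 * ρ δ s) (𝓝[>] 0) (𝓝 0) := by
  have hM := h.M_pos
  obtain ⟨K, hK0, hK⟩ := h.uniformlyO_ρ
  have hle : ∀ δ ∈ Ioo 0 δ₀, ‖∫ s in b..c, s ^ 2 * ρ δ s‖ ≤ c ^ 2 * (K * δ) * |c - b| := by
    intro δ hδ
    refine norm_integral_le_of_norm_le_const fun s hs => ?_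
    rw [uIoc_of_le hbc] at hs
    have hs' : 2 * M < s := hb.trans_lt hs.1
    have hs0 : 0 < s := lt_trans (by positivity) hs'
    have h1 := hK δ hδ s hs'
    rw [sub_zero] at h1
    rw [norm_mul, norm_pow, Real.norm_eq_abs, Real.norm_eq_abs, abs_of_pos hs0]
    have := hs.2
    gcongr
  have hlim : Tendsto (fun δ : ℝ => c ^ 2 * (K * δ) * |c - b|) (𝓝[>] 0) (𝓝 0) := by
    have : Continuous fun δ : ℝ => c ^ 2 * (K * δ) * |c - b| := by fun_prop
    simpa using (this.tendsto 0).mono_left nhdsWithin_le_nhds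
  have h0 := squeeze_zero_norm' (eventually_of_mem (Ioo_mem_nhdsGT h.δ₀_pos) hle) hlim
  simpa using h0.const_mul (4 * π)

theorem uniformlyO_iteratedDeriv (h : ShellFamily M a R C D₁ δ₀ y m ρ p p') {yinf : ℝ → ℝ}
    (hy : ∀ δ ∈ Ioo 0 δ₀, Tendsto (y δ) atTop (𝓝 (yinf δ))) {k : ℕ} (hk : k ≤ 2) :
    UniformlyO δ₀ (Ioi (2 * M)) (fun δ r => iteratedDeriv k (fun s => yinf δ - y δ s) r)
      (fun r => iteratedDeriv k (fun s => 1 / 2 * Real.log (1 - 2 * M / s)) r) := by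
  have hM := h.M_pos
  have hS := ShellSolution.schwarzschild (a := a) hM
  have hS₁ := hS.hasDerivAt_const_sub 0
  simp only [zero_sub, neg_neg] at hS₁
  interval_cases k
  · simpa only [iteratedDeriv_zero] using h.uniformlyO_potential hy
  · simp only [iteratedDeriv_one]
    exact h.uniformlyO_shellSlope.congr
      (fun δ hδ r hr => ((h.sol δ hδ).hasDerivAt_const_sub _ r hr).deriv.symm)
      fun r hr => (hS₁ r hr).deriv.symm
  · exact h.uniformlyO_shellCurvature.congr
      (fun δ hδ r hr => (iteratedDeriv_two_eq_of_hasDerivAt isOpen_Ioi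
        ((h.sol δ hδ).hasDerivAt_const_sub _) ((h.sol δ hδ).hasDerivAt_shellSlope hM) hr).symm)
      fun r hr => (iteratedDeriv_two_eq_of_hasDerivAt isOpen_Ioi hS₁
        (hS.hasDerivAt_shellSlope hM) hr).symm

end ShellFamily

theorem stmt_7
    (M l α₀ L₀ E0 sL rL Rmin Rmax η₀ : ℝ)
    (Φ χ : ℝ → ℝ)
    (hM : 0 < M) (hl : -(1/2) < l)
    (hΦmeas : Measurable Φ) (hΦnonneg : ∀ x, 0 ≤ Φ x)
    (hΦzero : ∀ x ≤ 0, Φ x = 0)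
    (hα₀ : 0 < α₀) (hΦpos : ∀ x ∈ Ioo 0 α₀, 0 < Φ x)
    (hΦloc : ∀ a b : ℝ, BddAbove (Φ '' Icc a b))
    (hL₀ : 12 * M ^ 2 < L₀)
    (hsL : 2 * M < sL) (hsLrL : sL < rL)
    (hds : deriv (Psi0 M L₀) sL = 0) (hdr : deriv (Psi0 M L₀) rL = 0)
    (hmax : IsLocalMax (Psi0 M L₀) sL) (hmin : IsLocalMin (Psi0 M L₀) rL)
    (hE0l : Psi0 M L₀ rL < E0) (hE0u : E0 < min 1 (Psi0 M L₀ sL))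
    (hRmin1 : sL < Rmin) (hRmin2 : Rmin < rL) (hRmin3 : Psi0 M L₀ Rmin = E0)
    (hRmin4 : 4 * M < Rmin)
    (hRmax1 : rL < Rmax) (hRmax2 : Psi0 M L₀ Rmax = E0)
    (hη₀ : 0 < η₀) (hr₀η₀ : sL + η₀ < Rmin)
    (hχ : ContDiff ℝ (⊤ : ℕ∞) χ) (hχnonneg : ∀ x, 0 ≤ χ x)
    (hχ0 : ∀ x ≤ 0, χ x = 0) (hχ1 : ∀ x, η₀ ≤ x → χ x = 1)
    (Y : ℝ → ℝ → ℝ)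
    (hY : ∀ δ : ℝ, 0 ≤ δ →
      IsShellSolution M l L₀ δ sL (Real.log (Real.sqrt 2 * E0)) Φ χ (Y δ))
    (yinf : ℝ → ℝ)
    (hyinf : ∀ δ : ℝ, 0 ≤ δ → Tendsto (Y δ) atTop (𝓝 (yinf δ))) :
    TendstoUniformlyOn (fun δ r => rhoFun l L₀ δ sL Φ χ (Y δ) r)
      (fun _ => 0) (𝓝[>] (0:ℝ)) (Ioi (2 * M)) ∧
    TendstoUniformlyOn (fun δ r => pFun l L₀ δ sL Φ χ (Y δ) r)
      (fun _ => 0) (𝓝[>] (0:ℝ)) (Ioi (2 * M)) ∧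
    TendstoUniformlyOn
      (fun δ r => -(1/2) * Real.log (1 - (2 / r) * (M + mFun M l L₀ δ sL Φ χ (Y δ) r)))
      (fun r => -(1/2) * Real.log (1 - 2 * M / r)) (𝓝[>] (0:ℝ)) (Ioi (2 * M)) ∧
    Tendsto (fun δ => 4 * π * ∫ s in Rmin..Rmax, s ^ 2 * rhoFun l L₀ δ sL Φ χ (Y δ) s)
      (𝓝[>] (0:ℝ)) (𝓝 0) ∧
    Tendsto (fun δ => Real.exp (yinf δ)) (𝓝[>] (0:ℝ)) (𝓝 E0) ∧
    (∀ δ : ℝ, 0 < δ → ContDiffOn ℝ 2 (fun r => yinf δ - Y δ r) (Ioi (2 * M))) ∧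
    (∀ k : ℕ, k ≤ 2 →
      TendstoUniformlyOn (fun δ r => iteratedDeriv k (fun s => yinf δ - Y δ s) r)
        (fun r => iteratedDeriv k (fun s => (1/2) * Real.log (1 - 2 * M / s)) r)
        (𝓝[>] (0:ℝ)) (Ioi (2 * M))) := by
  have hL : 0 ≤ L₀ := le_trans (by positivity) hL₀.le
  have hE : 0 < E0 := lt_of_le_of_lt (mul_nonneg (sqrt_nonneg _) (sqrt_nonneg _)) hE0l
  have hE1 : E0 < 1 := hE0u.trans_le (min_le_left _ _)
  obtain ⟨K, hK⟩ := hΦloc 0 1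
  have hΦK : ∀ α ∈ Icc (0:ℝ) 1, |Φ α| ≤ K := fun α hα => by
    rw [abs_of_nonneg (hΦnonneg α)]
    exact hK (mem_image_of_mem _ hα)
  have hsol : ∀ δ, 0 ≤ δ → ShellSolution M sL (Y δ) (mFun M l L₀ δ sL Φ χ (Y δ))
      (rhoFun l L₀ δ sL Φ χ (Y δ)) (pFun l L₀ δ sL Φ χ (Y δ))
      (pDeriv l L₀ δ sL Φ χ (Y δ)) := fun δ hδ =>
    ShellSolution.of_isShellSolution hM hl hΦmeas hΦK hΦnonneg hL hsL hχ hχnonneg hχ0 hδ (hY δ hδ)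
  obtain ⟨R, C, D₁, δ₀, haR, hC, hD₁, hδ₀, hbd⟩ := exists_shellBounds hM hl hΦmeas hΦK hΦnonneg
    hα₀ hΦpos hL hsL hχ hχnonneg hχ0 hE hE1
  have hfam : ShellFamily M sL R C D₁ δ₀ Y (fun δ => mFun M l L₀ δ sL Φ χ (Y δ))
      (fun δ => rhoFun l L₀ δ sL Φ χ (Y δ)) (fun δ => pFun l L₀ δ sL Φ χ (Y δ))
      (fun δ => pDeriv l L₀ δ sL Φ χ (Y δ)) :=
    ⟨hM, hsL, haR, hC, hD₁, hδ₀, fun δ hδ => hsol δ hδ.1.le,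
      fun δ hδ => hbd δ hδ.1 hδ.2 _ (hY δ hδ.1.le)⟩
  have hy : ∀ δ ∈ Ioo 0 δ₀, Tendsto (Y δ) atTop (𝓝 (yinf δ)) := fun δ hδ => hyinf δ hδ.1.le
  refine ⟨hfam.uniformlyO_ρ.tendstoUniformlyOn hδ₀, hfam.uniformlyO_p.tendstoUniformlyOn hδ₀, ?_,
    hfam.tendsto_shell_mass (hsL.trans hRmin1).le (hRmin2.trans hRmax1).le,
    hfam.tendsto_exp_limit hE hy fun δ hδ => (hY δ hδ.1.le).2.1, fun δ hδ => ?_,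
    fun k hk => (hfam.uniformlyO_iteratedDeriv hy hk).tendstoUniformlyOn hδ₀⟩
  · refine ((hfam.uniformlyO_log_D.const_mul (g := fun _ => -(1 / 2))
      fun _ _ => le_rfl).congr (fun _ _ _ _ => rfl) fun r _ => ?_).tendstoUniformlyOn hδ₀
    rw [add_zero, div_mul_eq_mul_div]
  · exact contDiffOn_two_of_hasDerivAt isOpen_Ioi ((hsol δ hδ.le).hasDerivAt_const_sub _)
      ((hsol δ hδ.le).hasDerivAt_shellSlope hM) ((hsol δ hδ.le).continuousOn_shellCurvature hM)

end
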